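/- arXiv:2404.17349 — 6 statements merged into one kernel-verified Lean document; each statement's English description precedes it below -/
import Mathlib

section
/- Let σ be a permutation of [n] and I, J nonempty consecutive intervals of [n]. Let i be the element of I maximizing σ^{-1} over I and j the element of J minimizing σ^{-1} over J. Then the linear functional x ↦ Σ_{k∈[n]} σ^{-1}(k)·x_k attains its maximum over conv({0} ∪ {e_a − e_b : a ∈ I, b ∈ J}) at the unique point e_i − e_j if σ^{-1}(i) > σ^{-1}(j), and at the unique point 0 otherwise. Dually, let i' be the element of I minimizing σ^{-1} over I and j' the element of J maximizing σ^{-1} over J; the same functional attains its maximum over conv({0} ∪ {e_b − e_a : a ∈ I, b ∈ J}) at the unique point e_{j'} − e_{i'} if σ^{-1}(i') < σ^{-1}(j'), and at the unique point 0 otherwise. (These polytopes are translates of the shard polytopes of the yin arc yin(I,J) and the yang arc yang(I,J), respectively.) -/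
open Classical Pointwise

noncomputable section

/-- An interval of `[n]`: a nonempty set of consecutive integers. -/
def IsInterval {n : ℕ} (I : Finset (Fin n)) : Prop :=
  I.Nonempty ∧ ∀ a b c : Fin n, a ∈ I → c ∈ I → a ≤ b → b ≤ c → b ∈ I

/-- Two intervals `I`, `J` of `[n]` are consecutive if `max I = min J − 1`. -/
def ConsecIntervals {n : ℕ} (I J : Finset (Fin n)) : Prop :=
  ∃ (hI : IsInterval I) (hJ : IsInterval J),
    (I.max' hI.1 : ℕ) + 1 = (J.min' hJ.1 : ℕ)

/-- The standard basis vector `e i` of `ℝ^n`. -/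
def stdVec (n : ℕ) (i : Fin n) : Fin n → ℝ := fun k => if k = i then 1 else 0

/-- `f_≍(X)`: number of intervals of `[n]` contained neither in `X` nor in its complement. -/
def fWeak (n : ℕ) (X : Finset (Fin n)) : ℕ :=
  {I : Finset (Fin n) | IsInterval I ∧ ¬ I ⊆ X ∧ ¬ I ⊆ Xᶜ}.ncard

/-- `f_⥮(X)`. -/
def fStrong (n : ℕ) (X : Finset (Fin n)) : ℕ :=
  {p : Finset (Fin n) × Finset (Fin n) |
      ConsecIntervals p.1 p.2 ∧ ¬ p.1 ⊆ X ∧ ¬ p.2 ⊆ Xᶜ}.ncard +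
  {p : Finset (Fin n) × Finset (Fin n) |
      ConsecIntervals p.1 p.2 ∧ ¬ p.1 ⊆ Xᶜ ∧ ¬ p.2 ⊆ X}.ncard


theorem hull_aux {n : ℕ} (w : Fin n → ℝ) (S : Set (Fin n → ℝ)) (p : Fin n → ℝ) (hp : p ∈ S)
    (h : ∀ s ∈ S, s ≠ p → (∑ k, w k * s k) < ∑ k, w k * p k) :
    {y ∈ convexHull ℝ S | ∀ z ∈ convexHull ℝ S, (∑ k, w k * z k) ≤ ∑ k, w k * y k} = {p} := by
  have hT : convexHull ℝ S ⊆ {x | x = p ∨ (∑ k, w k * x k) < ∑ k, w k * p k} := by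
    apply convexHull_min
    · intro s hs
      by_cases hsp : s = p
      · exact Or.inl hsp
      · exact Or.inr (h s hs hsp)
    · intro x hx y hy a b ha hb hab
      have key : (∑ k, w k * (a • x + b • y) k)
          = a * (∑ k, w k * x k) + b * ∑ k, w k * y k := by
        rw [Finset.mul_sum, Finset.mul_sum, ← Finset.sum_add_distrib]
        refine Finset.sum_congr rfl fun k _ => ?_
        simp only [Pi.add_apply, Pi.smul_apply, smul_eq_mul]
        ring
      simp only [Set.mem_setOf_eq] at hx hy ⊢
      rw [key]
      have hb' : b = 1 - a := by linarith
      rcases ha.eq_or_lt with ha0 | ha0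
      · have : b = 1 := by linarith
        subst this
        subst ha0
        simpa using hy
      rcases hb.eq_or_lt with hb0 | hb0
      · have : a = 1 := by linarith
        subst this
        subst hb0
        simpa using hx
      rcases hx with hx | hx <;> rcases hy with hy | hy
      · left
        rw [hx, hy, ← add_smul, hab, one_smul]
      all_goals
        right
        subst hb'
        try subst hx
        try subst hy
        nlinarith
  ext y
  simp only [Set.mem_setOf_eq, Set.mem_singleton_iff]
  constructor
  · rintro ⟨hy, hz⟩
    rcases hT hy with h1 | h1
    · exact h1
    · exact absurd (hz p (subset_convexHull ℝ S hp)) (not_le.mpr h1)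
  · rintro rfl
    refine ⟨subset_convexHull ℝ S hp, fun z hz => ?_⟩
    rcases hT hz with h1 | h1
    · rw [h1]
    · exact le_of_lt h1

theorem eval_aux {n : ℕ} (w : Fin n → ℝ) (a b : Fin n) :
    (∑ k, w k * (stdVec n a - stdVec n b) k) = w a - w b := by
  simp [stdVec, mul_sub, Finset.sum_sub_distrib]

theorem max_aux {n : ℕ} (τ : Equiv.Perm (Fin n)) (A B : Finset (Fin n))
    (hAB : ∀ a ∈ A, ∀ b ∈ B, a ≠ b) (S : Set (Fin n → ℝ))
    (hS : S = insert 0 {x | ∃ a ∈ A, ∃ b ∈ B, x = stdVec n a - stdVec n b})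
    (i : Fin n) (hi : i ∈ A) (j : Fin n) (hj : j ∈ B)
    (hmi : ∀ k ∈ A, τ k ≤ τ i) (hmj : ∀ k ∈ B, τ j ≤ τ k) :
    {y ∈ convexHull ℝ S | ∀ z ∈ convexHull ℝ S,
      (∑ k, ((τ k : ℕ) : ℝ) * z k) ≤ ∑ k, ((τ k : ℕ) : ℝ) * y k} =
      (if τ j < τ i then {stdVec n i - stdVec n j} else {0}) := by
  have hw : ∀ a b, τ a ≤ τ b → ((τ a : ℕ) : ℝ) ≤ ((τ b : ℕ) : ℝ) := by
    intro a b hab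
    exact_mod_cast hab
  have hw' : ∀ a b, τ a ≤ τ b → a ≠ b → ((τ a : ℕ) : ℝ) < ((τ b : ℕ) : ℝ) := by
    intro a b hab hne
    have : τ a < τ b := lt_of_le_of_ne hab (fun h => hne (τ.injective h))
    exact_mod_cast this
  have ev := eval_aux (fun k : Fin n => ((τ k : ℕ) : ℝ))
  have hij := hAB i hi j hj
  split_ifs with hlt
  · apply hull_aux (fun k : Fin n => ((τ k : ℕ) : ℝ))
    · rw [hS]
      exact Or.inr ⟨i, hi, j, hj, rfl⟩
    · intro s hs hne
      rw [hS] at hs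
      rw [ev]
      rcases hs with rfl | ⟨a, ha, b, hb, rfl⟩
      · simpa using hlt
      · rw [ev]
        by_cases hai : a = i
        · by_cases hbj : b = j
          · exact absurd (by rw [hai, hbj]) hne
          · have h1 := hw a i (hmi a ha)
            have h2 := hw' j b (hmj b hb) (Ne.symm hbj)
            linarith
        · have h1 := hw' a i (hmi a ha) hai
          have h2 := hw j b (hmj b hb)
          linarith
  · apply hull_aux (fun k : Fin n => ((τ k : ℕ) : ℝ))
    · rw [hS]
      exact Or.inl rfl
    · intro s hs hne
      rw [hS] at hs
      rcases hs with rfl | ⟨a, ha, b, hb, rfl⟩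
      · exact absurd rfl hne
      · rw [ev]
        have h0 := hw' i j (not_lt.mp hlt) hij
        have h1 := hw a i (hmi a ha)
        have h2 := hw j b (hmj b hb)
        simp only [Pi.zero_apply, mul_zero, Finset.sum_const_zero]
        linarith

/-- over `conv({0} ∪ {e_a − e_b : a ∈ I, b ∈ J})` (a translate
of the yin shard polytope), the functional `x ↦ Σ_k σ⁻¹(k)·x_k` attains its
maximum at the unique point `e_i − e_j` if `σ⁻¹(i) > σ⁻¹(j)` and at the unique
point `0` otherwise, where `i` maximizes `σ⁻¹` over `I` and `j` minimizes `σ⁻¹`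
over `J`; dually for `conv({0} ∪ {e_b − e_a : a ∈ I, b ∈ J})` (a translate of
the yang shard polytope). -/
theorem yin_yang_maximizer (n : ℕ) (σ : Equiv.Perm (Fin n))
    (I J : Finset (Fin n)) (hI : IsInterval I) (hJ : IsInterval J)
    (hc : (I.max' hI.1 : ℕ) + 1 = (J.min' hJ.1 : ℕ)) :
    (∀ i ∈ I, ∀ j ∈ J, (∀ k ∈ I, σ.symm k ≤ σ.symm i) → (∀ k ∈ J, σ.symm j ≤ σ.symm k) →
      {y ∈ convexHull ℝ
            (insert 0 {x : Fin n → ℝ | ∃ a ∈ I, ∃ b ∈ J, x = stdVec n a - stdVec n b}) |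
          ∀ z ∈ convexHull ℝ
            (insert 0 {x : Fin n → ℝ | ∃ a ∈ I, ∃ b ∈ J, x = stdVec n a - stdVec n b}),
            (∑ k, ((σ.symm k : ℕ) : ℝ) * z k) ≤ ∑ k, ((σ.symm k : ℕ) : ℝ) * y k} =
        (if σ.symm j < σ.symm i then {stdVec n i - stdVec n j} else {0})) ∧
    (∀ i ∈ I, ∀ j ∈ J, (∀ k ∈ I, σ.symm i ≤ σ.symm k) → (∀ k ∈ J, σ.symm k ≤ σ.symm j) →
      {y ∈ convexHull ℝ
            (insert 0 {x : Fin n → ℝ | ∃ a ∈ I, ∃ b ∈ J, x = stdVec n b - stdVec n a}) |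
          ∀ z ∈ convexHull ℝ
            (insert 0 {x : Fin n → ℝ | ∃ a ∈ I, ∃ b ∈ J, x = stdVec n b - stdVec n a}),
            (∑ k, ((σ.symm k : ℕ) : ℝ) * z k) ≤ ∑ k, ((σ.symm k : ℕ) : ℝ) * y k} =
        (if σ.symm i < σ.symm j then {stdVec n j - stdVec n i} else {0})) := by
  have hIJ : ∀ a ∈ I, ∀ b ∈ J, a ≠ b := by
    intro a ha b hb hab
    have h1 : (a : ℕ) ≤ (I.max' hI.1 : ℕ) := I.le_max' a ha
    have h2 : (J.min' hJ.1 : ℕ) ≤ (b : ℕ) := J.min'_le b hb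
    subst hab
    omega
  refine ⟨fun i hi j hj hmi hmj => max_aux σ.symm I J hIJ _ rfl i hi j hj hmi hmj,
    fun i hi j hj hmi hmj => max_aux σ.symm J I (fun a ha b hb => (hIJ b hb a ha).symm) _ ?_
      j hj i hi hmj hmi⟩
  congr 1
  ext x
  constructor
  · rintro ⟨a, ha, b, hb, h⟩
    exact ⟨b, hb, a, ha, h⟩
  · rintro ⟨a, ha, b, hb, h⟩
    exact ⟨b, hb, a, ha, h⟩

end
end

section
/- Let R be a generic rectangulation of size n with target tree T = T(R) and weak poset ≺_w^R, let σ be a permutation of [n] that is a linear extension of ≺_w^R (i.e., i ≺_w^R j implies σ^{-1}(i) < σ^{-1}(j)), and let i ∈ [n]. Then the number of intervals I of [n] (of any size, including the singleton {i}) such that i ∈ I and σ^{-1}(i) = max_{k∈I} σ^{-1}(k) equals h^T_i · v^T_i. In particular, this count is the same for every linear extension σ of ≺_w^R. -/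
open Classical Pointwise

noncomputable section

/-- A rectangulation of size `n`: a decomposition of the unit square into `n`
axis-parallel rectangles with pairwise disjoint interiors.  Rectangle `i` is
`[xl i, xr i] × [yb i, yt i]`. -/
structure Rectangulation (n : ℕ) where
  xl : Fin n → ℝ
  xr : Fin n → ℝ
  yb : Fin n → ℝ
  yt : Fin n → ℝ
  lt_x : ∀ i, xl i < xr i
  lt_y : ∀ i, yb i < yt i
  xl_nonneg : ∀ i, 0 ≤ xl i
  xr_le_one : ∀ i, xr i ≤ 1
  yb_nonneg : ∀ i, 0 ≤ yb i
  yt_le_one : ∀ i, yt i ≤ 1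
  interiors_disjoint : ∀ i j, i ≠ j →
    ¬ ∃ p : ℝ × ℝ, (xl i < p.1 ∧ p.1 < xr i ∧ yb i < p.2 ∧ p.2 < yt i) ∧
      (xl j < p.1 ∧ p.1 < xr j ∧ yb j < p.2 ∧ p.2 < yt j)
  cover : ∀ p : ℝ × ℝ, 0 ≤ p.1 → p.1 ≤ 1 → 0 ≤ p.2 → p.2 ≤ 1 →
    ∃ i, xl i ≤ p.1 ∧ p.1 ≤ xr i ∧ yb i ≤ p.2 ∧ p.2 ≤ yt i

namespace Rectangulation

variable {n : ℕ} (R : Rectangulation n)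

/-- `p` is a corner (vertex) of rectangle `i`. -/
def IsCorner (i : Fin n) (p : ℝ × ℝ) : Prop :=
  (p.1 = R.xl i ∨ p.1 = R.xr i) ∧ (p.2 = R.yb i ∨ p.2 = R.yt i)

/-- `R` is generic: no four rectangles have a common vertex. -/
def Generic : Prop :=
  ¬ ∃ (p : ℝ × ℝ) (i j k l : Fin n),
    i ≠ j ∧ i ≠ k ∧ i ≠ l ∧ j ≠ k ∧ j ≠ l ∧ k ≠ l ∧
    R.IsCorner i p ∧ R.IsCorner j p ∧ R.IsCorner k p ∧ R.IsCorner l p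

/-- `p` lies on a horizontal edge of some rectangle of `R`. -/
def OnHorizEdge (p : ℝ × ℝ) : Prop :=
  ∃ i, (p.2 = R.yb i ∨ p.2 = R.yt i) ∧ R.xl i ≤ p.1 ∧ p.1 ≤ R.xr i

/-- `p` lies on a vertical edge of some rectangle of `R`. -/
def OnVertEdge (p : ℝ × ℝ) : Prop :=
  ∃ i, (p.1 = R.xl i ∨ p.1 = R.xr i) ∧ R.yb i ≤ p.2 ∧ p.2 ≤ R.yt i

/-- The horizontal edges `[a₁,b₁] × {y}` and `[a₂,b₂] × {y}` lie on the same
(horizontal) segment of `R`: `y` is not on the boundary of the square and every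
point between the two edges lies on a horizontal edge of a rectangle. -/
def SameHSeg (y a₁ b₁ a₂ b₂ : ℝ) : Prop :=
  0 < y ∧ y < 1 ∧ ∀ x : ℝ, min a₁ a₂ ≤ x → x ≤ max b₁ b₂ → R.OnHorizEdge (x, y)

/-- The vertical edges `{x} × [a₁,b₁]` and `{x} × [a₂,b₂]` lie on the same
(vertical) segment of `R`. -/
def SameVSeg (x a₁ b₁ a₂ b₂ : ℝ) : Prop :=
  0 < x ∧ x < 1 ∧ ∀ y : ℝ, min a₁ a₂ ≤ y → y ≤ max b₁ b₂ → R.OnVertEdge (x, y)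

/-- Rectangle `i` is directly above `j`: the bottom edge of `i` lies on the same
segment as the top edge of `j`. -/
def DirAbove (i j : Fin n) : Prop :=
  R.yb i = R.yt j ∧ R.SameHSeg (R.yb i) (R.xl i) (R.xr i) (R.xl j) (R.xr j)

/-- Rectangle `i` is above `j`. -/
def Above : Fin n → Fin n → Prop := Relation.TransGen R.DirAbove

/-- Rectangle `i` is directly on the right of `j`: the left edge of `i` lies on
the same segment as the right edge of `j`. -/
def DirRightOf (i j : Fin n) : Prop :=
  R.xl i = R.xr j ∧ R.SameVSeg (R.xl i) (R.yb i) (R.yt i) (R.yb j) (R.yt j)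

/-- Rectangle `i` is on the right of `j`. -/
def RightOf : Fin n → Fin n → Prop := Relation.TransGen R.DirRightOf

/-- The inorder (NW–SE) order on the rectangles: the transitive closure of the
union of the below and right-of relations. -/
def InorderLT : Fin n → Fin n → Prop :=
  Relation.TransGen (fun i j => R.RightOf j i ∨ R.Above i j)

/-- The rectangles of `R` are labeled `1, …, n` in inorder. -/
def InorderLabeled : Prop := ∀ i j : Fin n, R.InorderLT i j ↔ i < j

/-- `q` is the parent of `r` via a horizontal edge in the source tree `S(R)`:
the bottom-right corner of `q` is the source (bottom-left corner) of `r`. -/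
def SEdgeH (q r : Fin n) : Prop := R.xr q = R.xl r ∧ R.yb q = R.yb r

/-- `q` is the parent of `r` via a vertical edge in the source tree `S(R)`:
the top-left corner of `q` is the source (bottom-left corner) of `r`. -/
def SEdgeV (q r : Fin n) : Prop := R.xl q = R.xl r ∧ R.yt q = R.yb r

/-- `q` is the parent of `r` via a horizontal edge in the target tree `T(R)`:
the top-left corner of `q` is the target (top-right corner) of `r`. -/
def TEdgeH (r q : Fin n) : Prop := R.xl q = R.xr r ∧ R.yt q = R.yt r

/-- `q` is the parent of `r` via a vertical edge in the target tree `T(R)`: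
the bottom-right corner of `q` is the target (top-right corner) of `r`. -/
def TEdgeV (r q : Fin n) : Prop := R.xr q = R.xr r ∧ R.yb q = R.yt r

/-- `a` is a descendant of `q` (or `a = q`) in the source tree. -/
def SReach : Fin n → Fin n → Prop :=
  Relation.ReflTransGen (fun a b => R.SEdgeH a b ∨ R.SEdgeV a b)

/-- `q` is an ancestor of `a` (or `a = q`) in the target tree. -/
def TReach : Fin n → Fin n → Prop :=
  Relation.ReflTransGen (fun a b => R.TEdgeH a b ∨ R.TEdgeV a b)

/-- `a` is a node of the vertical subtree of `i` in the target tree. -/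
def VSubT (i a : Fin n) : Prop := ∃ r, R.TEdgeV r i ∧ R.TReach a r

/-- `a` is a node of the horizontal subtree of `i` in the target tree. -/
def HSubT (i a : Fin n) : Prop := ∃ r, R.TEdgeH r i ∧ R.TReach a r

/-- `a` is a node of the vertical subtree of `i` in the source tree. -/
def VSubS (i a : Fin n) : Prop := ∃ r, R.SEdgeV i r ∧ R.SReach r a

/-- `a` is a node of the horizontal subtree of `i` in the source tree. -/
def HSubS (i a : Fin n) : Prop := ∃ r, R.SEdgeH i r ∧ R.SReach r a

/-- `h^T_i`: the number of leaves of the horizontal subtree of `i` in the target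
tree (a binary tree with `k` nodes has `k + 1` leaves). -/
def hT (i : Fin n) : ℕ := 1 + {a | R.HSubT i a}.ncard

/-- `v^T_i`. -/
def vT (i : Fin n) : ℕ := 1 + {a | R.VSubT i a}.ncard

/-- `h^S_i`. -/
def hS (i : Fin n) : ℕ := 1 + {a | R.HSubS i a}.ncard

/-- `v^S_i`. -/
def vS (i : Fin n) : ℕ := 1 + {a | R.VSubS i a}.ncard

/-- The node `a` of the target tree carries a vertical leaf. -/
def TVLeaf (a : Fin n) : Prop := ¬ ∃ r, R.TEdgeV r a

/-- The node `a` of the target tree carries a horizontal leaf. -/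
def THLeaf (a : Fin n) : Prop := ¬ ∃ r, R.TEdgeH r a

/-- The node `b` of the source tree carries a vertical leaf. -/
def SVLeaf (b : Fin n) : Prop := ¬ ∃ r, R.SEdgeV b r

/-- The node `b` of the source tree carries a horizontal leaf. -/
def SHLeaf (b : Fin n) : Prop := ¬ ∃ r, R.SEdgeH b r

/-- The vertical leaf of `T(R)` at `a` and the vertical leaf of `S(R)` at `b`
are common leaves: the edges to their parents lie on the same (vertical)
segment of `R` (the one supporting the right edge of `a` and the left edge of `b`). -/
def CommonVLeaf (a b : Fin n) : Prop :=
  R.TVLeaf a ∧ R.SVLeaf b ∧ R.xr a = R.xl b ∧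
    R.SameVSeg (R.xr a) (R.yb a) (R.yt a) (R.yb b) (R.yt b)

/-- The horizontal leaf of `T(R)` at `a` and the horizontal leaf of `S(R)` at `b`
are common leaves: the edges to their parents lie on the same (horizontal)
segment of `R` (supporting the top edge of `a` and the bottom edge of `b`). -/
def CommonHLeaf (a b : Fin n) : Prop :=
  R.THLeaf a ∧ R.SHLeaf b ∧ R.yt a = R.yb b ∧
    R.SameHSeg (R.yt a) (R.xl a) (R.xr a) (R.xl b) (R.xr b)

/-- `cv^{T,S}_{i,j}`: the number of common leaves of the vertical subtree of `i`
in `T(R)` and the vertical subtree of `j` in `S(R)`. -/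
def cv (i j : Fin n) : ℕ :=
  {p : Fin n × Fin n |
    (R.CommonVLeaf p.1 p.2 ∧ (R.VSubT i p.1 ∨ p.1 = i) ∧ (R.VSubS j p.2 ∨ p.2 = j)) ∨
    (R.CommonHLeaf p.1 p.2 ∧ R.VSubT i p.1 ∧ R.VSubS j p.2)}.ncard

/-- `ch^{S,T}_{i,j}`: the number of common leaves of the horizontal subtree of `i`
in `S(R)` and the horizontal subtree of `j` in `T(R)`. -/
def ch (i j : Fin n) : ℕ :=
  {p : Fin n × Fin n |
    (R.CommonHLeaf p.2 p.1 ∧ (R.HSubS i p.1 ∨ p.1 = i) ∧ (R.HSubT j p.2 ∨ p.2 = j)) ∨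
    (R.CommonVLeaf p.2 p.1 ∧ R.HSubS i p.1 ∧ R.HSubT j p.2)}.ncard

/-- The weak poset `≺_w^R`: the transitive closure of the union of the partial
orders given by the edges of `S(R)` and of `T(R)`, horizontal edges oriented
left to right and vertical edges bottom to top. -/
def PrecW : Fin n → Fin n → Prop :=
  Relation.TransGen (fun a b => R.SEdgeH a b ∨ R.SEdgeV a b ∨ R.TEdgeH a b ∨ R.TEdgeV a b)

/-- One step of the adjacency relation: `r_i` and `r_j` share part of a segment
of `R`, and `r_i` lies to the left of or below `r_j`. -/
def AdjStep (i j : Fin n) : Prop :=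
  (R.xr i = R.xl j ∧ max (R.yb i) (R.yb j) < min (R.yt i) (R.yt j)) ∨
  (R.yt i = R.yb j ∧ max (R.xl i) (R.xl j) < min (R.xr i) (R.xr j))

/-- The special relation `i ◁◁ j`. -/
def Special (i j : Fin n) : Prop :=
  (R.xr j = R.xl i ∧ R.SameVSeg (R.xl i) (R.yb j) (R.yt j) (R.yb i) (R.yt i) ∧
    R.yt i < R.yb j) ∨
  (R.yt j = R.yb i ∧ R.SameHSeg (R.yb i) (R.xl j) (R.xr j) (R.xl i) (R.xr i) ∧
    R.xr i < R.xl j)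

/-- The strong poset `≺_s^R`: the transitive closure of the union of the
adjacency relation and the special relation. -/
def PrecS : Fin n → Fin n → Prop :=
  Relation.TransGen (fun a b => R.AdjStep a b ∨ R.Special a b)

/-- The vertical pattern `i‖j`: `r_i` and `r_j` share a vertical segment
containing the right edge of `r_i` and the left edge of `r_j`, and the bottom
edge of `r_i` is below the top edge of `r_j`. -/
def VertPattern (i j : Fin n) : Prop :=
  R.xr i = R.xl j ∧ R.SameVSeg (R.xr i) (R.yb i) (R.yt i) (R.yb j) (R.yt j) ∧
    R.yb i < R.yt j

/-- The horizontal pattern `i⦀j`: `r_i` and `r_j` share a horizontal segment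
containing the bottom edge of `r_i` and the top edge of `r_j`, and the right
edge of `r_i` is to the right of the left edge of `r_j`. -/
def HorPattern (i j : Fin n) : Prop :=
  R.yb i = R.yt j ∧ R.SameHSeg (R.yb i) (R.xl i) (R.xr i) (R.xl j) (R.xr j) ∧
    R.xl j < R.xr i

end Rectangulation


section AbstractTree

variable {α : Type*} [LinearOrder α]

/-- Reachability towards the root in a binary tree with edge relations `H`, `V`. -/
def BReach (H V : α → α → Prop) : α → α → Prop :=
  Relation.ReflTransGen (fun a b => H a b ∨ V a b)

/-- Abstract binary search tree together with a decreasing labeling `f`. -/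
structure BST (H V : α → α → Prop) (f : α → ℕ) : Prop where
  uH : ∀ r r' q, H r q → H r' q → r = r'
  uV : ∀ r r' q, V r q → V r' q → r = r'
  par : ∀ a b c, (H a b ∨ V a b) → (H a c ∨ V a c) → b = c
  bH : ∀ a r q, H r q → BReach H V a r → a < q
  bV : ∀ a r q, V r q → BReach H V a r → q < a
  root : ∃ t, ∀ a, BReach H V a t
  inj : Function.Injective f
  mono : ∀ a b, (H a b ∨ V a b) → f a < f b

theorem BReach.flip {H V : α → α → Prop} {a b : α} (h : BReach H V a b) :
    BReach V H a b := by
  induction h with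
  | refl => exact Relation.ReflTransGen.refl
  | tail _ h2 ih => exact Relation.ReflTransGen.tail ih h2.symm

theorem BST.flip {H V : α → α → Prop} {f : α → ℕ} (B : BST H V f) :
    BST (α := αᵒᵈ) V H f where
  uH := B.uV
  uV := B.uH
  par := fun a b c h1 h2 => B.par a b c h1.symm h2.symm
  bH := fun a r q h1 h2 => B.bV a r q h1 (BReach.flip h2)
  bV := fun a r q h1 h2 => B.bH a r q h1 (BReach.flip h2)
  root := by
    obtain ⟨t, ht⟩ := B.root
    exact ⟨t, fun a => BReach.flip (ht a)⟩
  inj := B.inj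
  mono := fun a b h => B.mono a b h.symm

theorem BST.reach_le {H V : α → α → Prop} {f : α → ℕ} (B : BST H V f) {a b : α}
    (h : BReach H V a b) : f a ≤ f b := by
  induction h with
  | refl => exact le_rfl
  | tail _ h2 ih => exact ih.trans (B.mono _ _ h2).le

theorem BST.lca {H V : α → α → Prop} {f : α → ℕ} (B : BST H V f) (a b : α) (hab : a ≤ b) :
    ∃ c, BReach H V a c ∧ BReach H V b c ∧ a ≤ c ∧ c ≤ b := by
  have key : ∀ m c, f c = m → BReach H V a c → BReach H V b c →
      ∃ c, BReach H V a c ∧ BReach H V b c ∧ a ≤ c ∧ c ≤ b := by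
    intro m
    induction m using Nat.strong_induction_on with
    | _ m ih =>
      intro c hc ha hb
      rcases Relation.ReflTransGen.cases_tail ha with h | ⟨r, har, hr⟩
      · subst h
        exact ⟨c, ha, hb, le_rfl, hab⟩
      rcases Relation.ReflTransGen.cases_tail hb with h | ⟨s, hbs, hs⟩
      · subst h
        exact ⟨c, ha, hb, hab, le_rfl⟩
      have hlt := B.mono _ _ hr
      rcases hr with hr | hr <;> rcases hs with hs | hs
      · have := B.uH _ _ _ hr hs
        subst this
        exact ih (f r) (by omega) r rfl har hbs
      · exact ⟨c, ha, hb, (B.bH _ _ _ hr har).le, (B.bV _ _ _ hs hbs).le⟩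
      · exact absurd ((B.bH _ _ _ hs hbs).trans (B.bV _ _ _ hr har)) (not_lt.mpr hab)
      · have := B.uV _ _ _ hr hs
        subst this
        exact ih (f r) (by omega) r rfl har hbs
  obtain ⟨t, ht⟩ := B.root
  exact key _ t rfl (ht a) (ht b)

theorem BST.chain {H V : α → α → Prop} {f : α → ℕ} (B : BST H V f) {a b c : α}
    (hb : BReach H V a b) (hc : BReach H V a c) : BReach H V b c ∨ BReach H V c b := by
  refine Relation.ReflTransGen.total_of_right_unique ?_ hb hc
  intro x y z hy hz
  exact B.par _ _ _ hy hz

theorem BST.left_iff {H V : α → α → Prop} {f : α → ℕ} (B : BST H V f) (i a : α) :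
    (∃ r, H r i ∧ BReach H V a r) ↔ (a < i ∧ ∀ k, a ≤ k → k ≤ i → f k ≤ f i) := by
  constructor
  · rintro ⟨r, hr, har⟩
    have hai := B.bH _ _ _ hr har
    refine ⟨hai, fun k hak hki => ?_⟩
    rcases hki.eq_or_lt with rfl | hki
    · exact le_rfl
    obtain ⟨c, hac, hkc, h1, h2⟩ := B.lca a k hak
    have hai' : BReach H V a i := Relation.ReflTransGen.tail har (Or.inl hr)
    rcases B.chain hac hai' with h | h
    · exact B.reach_le (hkc.trans h)
    · rcases Relation.ReflTransGen.cases_tail h with h | ⟨s, his, hs⟩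
      · subst h
        exact absurd (h2.trans_lt hki) (lt_irrefl _)
      · rcases hs with hs | hs
        · exact absurd ((B.bH _ _ _ hs his).trans_le h2) (not_lt.mpr hki.le)
        · exact absurd (B.bV _ _ _ hs (hai'.trans his)) (not_lt.mpr h1)
  · rintro ⟨hai, hk⟩
    obtain ⟨c, hac, hic, h1, h2⟩ := B.lca a i hai.le
    have hci : c = i := B.inj (le_antisymm (hk c h1 h2) (B.reach_le hic))
    subst hci
    rcases Relation.ReflTransGen.cases_tail hac with h | ⟨s, has, hs⟩
    · exact absurd h hai.ne'
    · rcases hs with hs | hs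
      · exact ⟨s, hs, has⟩
      · exact absurd (B.bV _ _ _ hs has) (not_lt.mpr hai.le)

theorem BST.right_iff {H V : α → α → Prop} {f : α → ℕ} (B : BST H V f) (i a : α) :
    (∃ r, V r i ∧ BReach H V a r) ↔ (i < a ∧ ∀ k, i ≤ k → k ≤ a → f k ≤ f i) := by
  have h := BST.left_iff (α := αᵒᵈ) B.flip i a
  constructor
  · rintro ⟨r, hr, har⟩
    obtain ⟨h1, h2⟩ := h.1 ⟨r, hr, BReach.flip har⟩
    exact ⟨h1, fun k hk1 hk2 => h2 k hk2 hk1⟩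
  · rintro ⟨h1, h2⟩
    obtain ⟨r, hr, har⟩ := h.2 ⟨h1, fun k hk1 hk2 => h2 k hk2 hk1⟩
    exact ⟨r, hr, BReach.flip har⟩

end AbstractTree

theorem interval_count {n : ℕ} (f : Fin n → ℕ) (i : Fin n) :
    {I : Finset (Fin n) | IsInterval I ∧ i ∈ I ∧ ∀ k ∈ I, f k ≤ f i}.ncard =
      (1 + {a : Fin n | a < i ∧ ∀ k, a ≤ k → k ≤ i → f k ≤ f i}.ncard) *
      (1 + {a : Fin n | i < a ∧ ∀ k, i ≤ k → k ≤ a → f k ≤ f i}.ncard) := by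
  set L : Set (Fin n) := {a : Fin n | a < i ∧ ∀ k, a ≤ k → k ≤ i → f k ≤ f i} with hL
  set U : Set (Fin n) := {a : Fin n | i < a ∧ ∀ k, i ≤ k → k ≤ a → f k ≤ f i} with hU
  have h1 : (insert i L).ncard = 1 + L.ncard := by
    rw [Set.ncard_insert_of_notMem (by simp [hL]), add_comm]
  have h2 : (insert i U).ncard = 1 + U.ncard := by
    rw [Set.ncard_insert_of_notMem (by simp [hU]), add_comm]
  rw [← h1, ← h2, ← Set.ncard_prod]
  have hl : ∀ a, a ∈ insert i L ↔ (a ≤ i ∧ ∀ k, a ≤ k → k ≤ i → f k ≤ f i) := by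
    intro a
    rw [Set.mem_insert_iff]
    constructor
    · rintro (rfl | h)
      · exact ⟨le_rfl, fun k h1 h2 => by rw [le_antisymm h1 h2]⟩
      · exact ⟨h.1.le, h.2⟩
    · rintro ⟨h, h'⟩
      rcases h.eq_or_lt with h | h
      · exact Or.inl h
      · exact Or.inr ⟨h, h'⟩
  have hu : ∀ a, a ∈ insert i U ↔ (i ≤ a ∧ ∀ k, i ≤ k → k ≤ a → f k ≤ f i) := by
    intro a
    rw [Set.mem_insert_iff]
    constructor
    · rintro (rfl | h)
      · exact ⟨le_rfl, fun k h1 h2 => by rw [le_antisymm h1 h2]⟩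
      · exact ⟨h.1.le, h.2⟩
    · rintro ⟨h, h'⟩
      rcases h.eq_or_lt with h | h
      · exact Or.inl h.symm
      · exact Or.inr ⟨h, h'⟩
  symm
  refine Set.ncard_congr (fun p _ => Finset.Icc p.1 p.2) ?_ ?_ ?_
  · rintro ⟨a, b⟩ ⟨ha, hb⟩
    simp only at ha hb
    rw [hl] at ha
    rw [hu] at hb
    refine ⟨⟨⟨i, Finset.mem_Icc.2 ⟨ha.1, hb.1⟩⟩, ?_⟩, Finset.mem_Icc.2 ⟨ha.1, hb.1⟩, ?_⟩
    · intro x y z hx hz hxy hyz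
      rw [Finset.mem_Icc] at *
      exact ⟨hx.1.trans hxy, hyz.trans hz.2⟩
    · intro k hk
      rw [Finset.mem_Icc] at hk
      rcases le_total k i with h | h
      · exact ha.2 k hk.1 h
      · exact hb.2 k h hk.2
  · rintro ⟨a, b⟩ ⟨c, d⟩ ⟨ha, hb⟩ ⟨hc, hd⟩ h
    simp only at ha hb hc hd h
    rw [hl] at ha hc
    rw [hu] at hb hd
    have e1 : a ∈ Finset.Icc c d := h ▸ Finset.mem_Icc.2 ⟨le_rfl, ha.1.trans hb.1⟩
    have e2 : b ∈ Finset.Icc c d := h ▸ Finset.mem_Icc.2 ⟨ha.1.trans hb.1, le_rfl⟩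
    have e3 : c ∈ Finset.Icc a b := h ▸ Finset.mem_Icc.2 ⟨le_rfl, hc.1.trans hd.1⟩
    have e4 : d ∈ Finset.Icc a b := h ▸ Finset.mem_Icc.2 ⟨hc.1.trans hd.1, le_rfl⟩
    rw [Finset.mem_Icc] at e1 e2 e3 e4
    exact Prod.ext (le_antisymm e3.1 e1.1) (le_antisymm e2.2 e4.2)
  · rintro I ⟨⟨hne, hI⟩, hi, hk⟩
    have hmin := I.min'_mem hne
    have hmax := I.max'_mem hne
    have m1 := I.min'_le i hi
    have m2 := I.le_max' i hi
    refine ⟨(I.min' hne, I.max' hne), ⟨?_, ?_⟩, ?_⟩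
    · exact (hl _).2 ⟨m1, fun k h1 h2 => hk k (hI _ k _ hmin hi h1 h2)⟩
    · exact (hu _).2 ⟨m2, fun k h1 h2 => hk k (hI _ k _ hi hmax h1 h2)⟩
    · ext x
      simp only [Finset.mem_Icc]
      constructor
      · rintro ⟨h1, h2⟩
        exact hI _ x _ hmin hmax h1 h2
      · intro hx
        exact ⟨I.min'_le x hx, I.le_max' x hx⟩

namespace Rectangulation

variable {n : ℕ} (R : Rectangulation n)

theorem overlap_eq {i j : Fin n} (h1 : R.xl i < R.xr j) (h2 : R.xl j < R.xr i)
    (h3 : R.yb i < R.yt j) (h4 : R.yb j < R.yt i) : i = j := by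
  by_contra hne
  have a1 : max (R.xl i) (R.xl j) < min (R.xr i) (R.xr j) := by
    simp [R.lt_x, h1, h2]
  have a2 : max (R.yb i) (R.yb j) < min (R.yt i) (R.yt j) := by
    simp [R.lt_y, h3, h4]
  obtain ⟨x, hx1, hx2⟩ := exists_between a1
  obtain ⟨y, hy1, hy2⟩ := exists_between a2
  rw [max_lt_iff] at hx1 hy1
  rw [lt_min_iff] at hx2 hy2
  exact R.interiors_disjoint i j hne ⟨(x, y), ⟨hx1.1, hx2.1, hy1.1, hy2.1⟩,
    ⟨hx1.2, hx2.2, hy1.2, hy2.2⟩⟩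

/-- Near a point of the square, in the direction `(s, t)`, there is a rectangle. -/
theorem exists_dir (x y s t : ℝ) (hin : ∃ δ > 0, ∀ e, 0 < e → e < δ →
      0 ≤ x + s * e ∧ x + s * e ≤ 1 ∧ 0 ≤ y + t * e ∧ y + t * e ≤ 1) :
    ∃ i, ∀ δ > 0, ∃ e, 0 < e ∧ e < δ ∧
      R.xl i ≤ x + s * e ∧ x + s * e ≤ R.xr i ∧ R.yb i ≤ y + t * e ∧ y + t * e ≤ R.yt i := by
  by_contra hcon
  push Not at hcon
  choose d hd hd' using hcon
  obtain ⟨δ, hδ, hin⟩ := hin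
  have : ∃ e, 0 < e ∧ e < δ ∧ ∀ i, e < d i := by
    have hfin : ∀ s : Finset (Fin n), ∃ e, 0 < e ∧ e < δ ∧ ∀ i ∈ s, e < d i := by
      intro s
      induction s using Finset.induction_on with
      | empty => exact ⟨δ / 2, by linarith, by linarith, by simp⟩
      | insert a s _ ih =>
        obtain ⟨e, h1, h2, h3⟩ := ih
        have := hd a
        refine ⟨min e (d a / 2), by positivity, lt_of_le_of_lt (min_le_left _ _) h2, ?_⟩
        intro j hj
        rcases Finset.mem_insert.1 hj with rfl | hj
        · exact lt_of_le_of_lt (min_le_right _ _) (by linarith)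
        · exact lt_of_le_of_lt (min_le_left _ _) (h3 j hj)
    obtain ⟨e, h1, h2, h3⟩ := hfin Finset.univ
    exact ⟨e, h1, h2, fun i => h3 i (Finset.mem_univ i)⟩
  obtain ⟨e, h1, h2, h3⟩ := this
  obtain ⟨b1, b2, b3, b4⟩ := hin e h1 h2
  obtain ⟨i, c1, c2, c3, c4⟩ := R.cover (x + s * e, y + t * e) b1 b2 b3 b4
  exact absurd c4 (not_le.mpr (hd' i e h1 (h3 i) c1 c2 c3))

theorem exists_SE (x y : ℝ) (hx0 : 0 ≤ x) (hx : x < 1) (hy0 : 0 < y) (hy : y ≤ 1) :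
    ∃ i, R.xl i ≤ x ∧ x < R.xr i ∧ R.yb i < y ∧ y ≤ R.yt i := by
  obtain ⟨i, hi⟩ := R.exists_dir x y 1 (-1) ⟨min (1 - x) y, by simp [hx, hy0], by
    intro e he he'
    rw [lt_min_iff] at he'
    refine ⟨?_, ?_, ?_, ?_⟩ <;> linarith [he'.1, he'.2]⟩
  refine ⟨i, ?_, ?_, ?_, ?_⟩
  · by_contra h
    obtain ⟨e, _, _, _⟩ := hi (R.xl i - x) (by linarith)
    linarith
  · obtain ⟨e, _, _, _⟩ := hi 1 one_pos
    linarith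
  · obtain ⟨e, _, _, _⟩ := hi 1 one_pos
    linarith
  · by_contra h
    obtain ⟨e, _, _, _⟩ := hi (y - R.yt i) (by linarith)
    linarith

theorem exists_NW (x y : ℝ) (hx0 : 0 < x) (hx : x ≤ 1) (hy0 : 0 ≤ y) (hy : y < 1) :
    ∃ i, R.xl i < x ∧ x ≤ R.xr i ∧ R.yb i ≤ y ∧ y < R.yt i := by
  obtain ⟨i, hi⟩ := R.exists_dir x y (-1) 1 ⟨min (1 - y) x, by simp [hy, hx0], by
    intro e he he'
    rw [lt_min_iff] at he'
    refine ⟨?_, ?_, ?_, ?_⟩ <;> linarith [he'.1, he'.2]⟩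
  refine ⟨i, ?_, ?_, ?_, ?_⟩
  · obtain ⟨e, _, _, _⟩ := hi 1 one_pos
    linarith
  · by_contra h
    obtain ⟨e, _, _, _⟩ := hi (x - R.xr i) (by linarith)
    linarith
  · by_contra h
    obtain ⟨e, _, _, _⟩ := hi (R.yb i - y) (by linarith)
    linarith
  · obtain ⟨e, _, _, _⟩ := hi 1 one_pos
    linarith

theorem exists_NE (x y : ℝ) (hx0 : 0 ≤ x) (hx : x < 1) (hy0 : 0 ≤ y) (hy : y < 1) :
    ∃ i, R.xl i ≤ x ∧ x < R.xr i ∧ R.yb i ≤ y ∧ y < R.yt i := by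
  obtain ⟨i, hi⟩ := R.exists_dir x y 1 1 ⟨min (1 - y) (1 - x), by simp [hy, hx], by
    intro e he he'
    rw [lt_min_iff] at he'
    refine ⟨?_, ?_, ?_, ?_⟩ <;> linarith [he'.1, he'.2]⟩
  refine ⟨i, ?_, ?_, ?_, ?_⟩
  · by_contra h
    obtain ⟨e, _, _, _⟩ := hi (R.xl i - x) (by linarith)
    linarith
  · obtain ⟨e, _, _, _⟩ := hi 1 one_pos
    linarith
  · by_contra h
    obtain ⟨e, _, _, _⟩ := hi (R.yb i - y) (by linarith)
    linarith
  · obtain ⟨e, _, _, _⟩ := hi 1 one_pos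
    linarith

theorem SE_at (a : Fin n) (hx : R.xr a < 1) :
    ∃ e, R.xl e = R.xr a ∧ R.yb e < R.yt a ∧ R.yt a ≤ R.yt e := by
  have := R.lt_x a; have := R.lt_y a; have := R.xl_nonneg a; have := R.yb_nonneg a
  obtain ⟨e, h1, h2, h3, h4⟩ := R.exists_SE (R.xr a) (R.yt a) (by linarith) hx (by linarith)
    (R.yt_le_one a)
  refine ⟨e, ?_, h3, h4⟩
  by_contra hne
  have hlt : R.xl e < R.xr a := lt_of_le_of_ne h1 hne
  have : e = a := R.overlap_eq hlt (by linarith) h3 (by linarith)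
  subst this
  exact lt_irrefl _ h2

theorem NW_at (a : Fin n) (hy : R.yt a < 1) :
    ∃ w, R.yb w = R.yt a ∧ R.xl w < R.xr a ∧ R.xr a ≤ R.xr w := by
  have := R.lt_x a; have := R.lt_y a; have := R.xl_nonneg a; have := R.yb_nonneg a
  obtain ⟨w, h1, h2, h3, h4⟩ := R.exists_NW (R.xr a) (R.yt a) (by linarith) (R.xr_le_one a)
    (by linarith) hy
  refine ⟨w, ?_, h1, h2⟩
  by_contra hne
  have hlt : R.yb w < R.yt a := lt_of_le_of_ne h3 hne
  have : w = a := R.overlap_eq h1 (by linarith) hlt (by linarith)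
  subst this
  exact lt_irrefl _ h4

theorem exists_parent (a : Fin n) (h : R.xr a < 1 ∨ R.yt a < 1) :
    ∃ q, R.TEdgeH a q ∨ R.TEdgeV a q := by
  by_cases hy : R.yt a < 1
  · obtain ⟨w, w1, w2, w3⟩ := R.NW_at a hy
    by_cases hx : R.xr a < 1
    · obtain ⟨e, e1, e2, e3⟩ := R.SE_at a hx
      rcases e3.eq_or_lt with e4 | e4
      · exact ⟨e, Or.inl ⟨e1, e4.symm⟩⟩
      rcases w3.eq_or_lt with w4 | w4
      · exact ⟨w, Or.inr ⟨w4.symm, w1⟩⟩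
      have := R.lt_x e
      have := R.lt_y w
      have : e = w := R.overlap_eq (by linarith) (by linarith) (by linarith) (by linarith)
      subst this
      linarith
    · have := R.xr_le_one w
      exact ⟨w, Or.inr ⟨by linarith, w1⟩⟩
  · have hx := h.resolve_right hy
    obtain ⟨e, e1, e2, e3⟩ := R.SE_at a hx
    have := R.yt_le_one e
    exact ⟨e, Or.inl ⟨e1, by linarith⟩⟩

theorem not_both (hgen : R.Generic) {a q w : Fin n} (h : R.TEdgeH a q) (h' : R.TEdgeV a w) :
    False := by
  obtain ⟨q1, q2⟩ := h
  obtain ⟨w1, w2⟩ := h'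
  have := R.lt_x a; have := R.lt_y a; have := R.xl_nonneg a; have := R.yb_nonneg a
  have := R.lt_x q; have := R.lt_y q; have := R.lt_x w; have := R.lt_y w
  have := R.xr_le_one q
  have := R.yt_le_one w
  obtain ⟨r, r1, r2, r3, r4⟩ := R.exists_NE (R.xr a) (R.yt a) (by linarith) (by linarith)
    (by linarith) (by linarith)
  have s1 : R.xl r = R.xr a := by
    by_contra hne
    have hlt := lt_of_le_of_ne r1 hne
    have : r = w := R.overlap_eq (by linarith) (by linarith) (by linarith) (by linarith)
    subst this
    linarith
  have s2 : R.yb r = R.yt a := by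
    by_contra hne
    have hlt := lt_of_le_of_ne r3 hne
    have : r = q := R.overlap_eq (by linarith) (by linarith) (by linarith) (by linarith)
    subst this
    linarith
  refine hgen ⟨(R.xr a, R.yt a), a, q, w, r, ?_, ?_, ?_, ?_, ?_, ?_,
    ⟨Or.inr rfl, Or.inr rfl⟩, ⟨Or.inl q1.symm, Or.inr q2.symm⟩,
    ⟨Or.inr w1.symm, Or.inl w2.symm⟩, ⟨Or.inl s1.symm, Or.inl s2.symm⟩⟩ <;>
  · rintro rfl
    linarith

theorem rightOf_lt (hlab : R.InorderLabeled) {a b : Fin n} (h : R.DirRightOf b a) : a < b :=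
  (hlab a b).1 (Relation.TransGen.single (Or.inl (Relation.TransGen.single h)))

theorem above_lt (hlab : R.InorderLabeled) {a b : Fin n} (h : R.DirAbove a b) : a < b :=
  (hlab a b).1 (Relation.TransGen.single (Or.inr (Relation.TransGen.single h)))

theorem dirRightOf_of_TEdgeH {a q : Fin n} (h : R.TEdgeH a q) : R.DirRightOf q a := by
  obtain ⟨h1, h2⟩ := h
  have := R.lt_x a; have := R.xl_nonneg a; have := R.lt_x q; have := R.xr_le_one q
  refine ⟨h1, by linarith, by linarith, fun y hy hy' => ?_⟩
  rw [h2, max_self] at hy'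
  rcases min_le_iff.1 hy with hy | hy
  · exact ⟨q, Or.inl rfl, hy, by simpa [h2] using hy'⟩
  · exact ⟨a, Or.inr h1, hy, hy'⟩

theorem dirAbove_of_TEdgeV {a q : Fin n} (h : R.TEdgeV a q) : R.DirAbove q a := by
  obtain ⟨h2, h1⟩ := h
  have := R.lt_y a; have := R.yb_nonneg a; have := R.lt_y q; have := R.yt_le_one q
  refine ⟨h1, by linarith, by linarith, fun y hy hy' => ?_⟩
  rw [h2, max_self] at hy'
  rcases min_le_iff.1 hy with hy | hy
  · exact ⟨q, Or.inl rfl, hy, by simpa [h2] using hy'⟩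
  · exact ⟨a, Or.inr h1, hy, hy'⟩

theorem dirRightOf_step {a b c : Fin n} (h : R.TEdgeV a b) (hc : R.DirRightOf c b) :
    R.DirRightOf c a := by
  obtain ⟨h1, h2⟩ := h
  obtain ⟨c1, c2, c3, c4⟩ := hc
  have hb := R.lt_y b
  refine ⟨by linarith, c2, c3, fun y hy hy' => ?_⟩
  by_cases hya : R.yb a ≤ y ∧ y ≤ R.yt a
  · exact ⟨a, Or.inr (by simp only; linarith), hya.1, hya.2⟩
  · refine c4 y ?_ ?_
    · rw [min_le_iff] at *
      by_contra hcon
      push Not at hcon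
      rcases hy with hy | hy
      · linarith
      · exact hya ⟨hy, by linarith⟩
    · rw [le_max_iff] at *
      rcases hy' with hy' | hy'
      · exact Or.inl hy'
      · exact Or.inr (by linarith)

theorem dirAbove_step {a b c : Fin n} (h : R.TEdgeH a b) (hc : R.DirAbove c b) :
    R.DirAbove c a := by
  obtain ⟨h2, h1⟩ := h
  obtain ⟨c1, c2, c3, c4⟩ := hc
  have hb := R.lt_x b
  refine ⟨by linarith, c2, c3, fun y hy hy' => ?_⟩
  by_cases hya : R.xl a ≤ y ∧ y ≤ R.xr a
  · exact ⟨a, Or.inr (by simp only; linarith), hya.1, hya.2⟩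
  · refine c4 y ?_ ?_
    · rw [min_le_iff] at *
      by_contra hcon
      push Not at hcon
      rcases hy with hy | hy
      · linarith
      · exact hya ⟨hy, by linarith⟩
    · rw [le_max_iff] at *
      rcases hy' with hy' | hy'
      · exact Or.inl hy'
      · exact Or.inr (by linarith)

theorem sub_lt (hlab : R.InorderLabeled) {a r q : Fin n} (h : R.TEdgeH r q)
    (har : R.TReach a r) : a < q := by
  have : ∃ c, c ≤ q ∧ R.DirRightOf c a := by
    induction har using Relation.ReflTransGen.head_induction_on with
    | refl => exact ⟨q, le_rfl, R.dirRightOf_of_TEdgeH h⟩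
    | head h1 _ ih =>
      obtain ⟨c, hc, hc'⟩ := ih
      rcases h1 with h1 | h1
      · exact ⟨_, (R.rightOf_lt hlab hc').le.trans hc, R.dirRightOf_of_TEdgeH h1⟩
      · exact ⟨c, hc, R.dirRightOf_step h1 hc'⟩
  obtain ⟨c, hc, hc'⟩ := this
  exact (R.rightOf_lt hlab hc').trans_le hc

theorem sub_gt (hlab : R.InorderLabeled) {a r q : Fin n} (h : R.TEdgeV r q)
    (har : R.TReach a r) : q < a := by
  have : ∃ c, q ≤ c ∧ R.DirAbove c a := by
    induction har using Relation.ReflTransGen.head_induction_on with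
    | refl => exact ⟨q, le_rfl, R.dirAbove_of_TEdgeV h⟩
    | head h1 _ ih =>
      obtain ⟨c, hc, hc'⟩ := ih
      rcases h1 with h1 | h1
      · exact ⟨c, hc, R.dirAbove_step h1 hc'⟩
      · exact ⟨_, hc.trans (R.above_lt hlab hc').le, R.dirAbove_of_TEdgeV h1⟩
  obtain ⟨c, hc, hc'⟩ := this
  exact hc.trans_lt (R.above_lt hlab hc')

theorem bst (hgen : R.Generic) (hlab : R.InorderLabeled) (f : Fin n → ℕ)
    (hf : Function.Injective f) (hn : 0 < n)
    (hm : ∀ a b, (R.TEdgeH a b ∨ R.TEdgeV a b) → f a < f b) :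
    BST R.TEdgeH R.TEdgeV f where
  uH := by
    rintro r r' q ⟨h1, h2⟩ ⟨h3, h4⟩
    have := R.lt_x r; have := R.lt_y r; have := R.lt_x r'; have := R.lt_y r'
    exact R.overlap_eq (by linarith) (by linarith) (by linarith) (by linarith)
  uV := by
    rintro r r' q ⟨h1, h2⟩ ⟨h3, h4⟩
    have := R.lt_x r; have := R.lt_y r; have := R.lt_x r'; have := R.lt_y r'
    exact R.overlap_eq (by linarith) (by linarith) (by linarith) (by linarith)
  par := by
    intro a b c h1 h2
    have := R.lt_x b; have := R.lt_y b; have := R.lt_x c; have := R.lt_y c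
    rcases h1 with h1 | h1 <;> rcases h2 with h2 | h2
    · obtain ⟨h1, h3⟩ := h1
      obtain ⟨h2, h4⟩ := h2
      exact R.overlap_eq (by linarith) (by linarith) (by linarith) (by linarith)
    · exact (R.not_both hgen h1 h2).elim
    · exact (R.not_both hgen h2 h1).elim
    · obtain ⟨h1, h3⟩ := h1
      obtain ⟨h2, h4⟩ := h2
      exact R.overlap_eq (by linarith) (by linarith) (by linarith) (by linarith)
  bH := fun a r q h h' => R.sub_lt hlab h h'
  bV := fun a r q h h' => R.sub_gt hlab h h'
  root := by
    have : Nonempty (Fin n) := ⟨⟨0, hn⟩⟩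
    obtain ⟨t, ht⟩ := Finite.exists_max f
    have ht1 : R.xr t = 1 ∧ R.yt t = 1 := by
      by_contra hcon
      have : R.xr t < 1 ∨ R.yt t < 1 := by
        by_contra h
        push Not at h
        exact hcon ⟨le_antisymm (R.xr_le_one t) h.1, le_antisymm (R.yt_le_one t) h.2⟩
      obtain ⟨q, hq⟩ := R.exists_parent t this
      exact absurd (hm _ _ hq) (not_lt.mpr (ht q))
    refine ⟨t, fun a => ?_⟩
    have key : ∀ m a, f t - f a = m → BReach R.TEdgeH R.TEdgeV a t := by
      intro m
      induction m using Nat.strong_induction_on with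
      | _ m ih =>
        intro a ha
        by_cases h : R.xr a < 1 ∨ R.yt a < 1
        · obtain ⟨q, hq⟩ := R.exists_parent a h
          have h1 := hm _ _ hq
          have h2 := ht q
          exact Relation.ReflTransGen.head hq (ih (f t - f q) (by omega) q rfl)
        · push Not at h
          have := R.lt_x a; have := R.lt_y a; have := R.lt_x t; have := R.lt_y t
          have := R.xr_le_one a; have := R.yt_le_one a
          obtain ⟨ht2, ht3⟩ := ht1
          have : a = t := R.overlap_eq (by linarith) (by linarith) (by linarith) (by linarith)
          subst this
          exact Relation.ReflTransGen.refl
    exact key _ a rfl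
  inj := hf
  mono := hm

end Rectangulation

/-- Loday coordinates of weak rectangulotopes: for a generic
inorder-labeled rectangulation `R` with target tree `T`, a linear extension `σ`
of the weak poset `≺_w^R`, and `i ∈ [n]`, the number of intervals `I` of `[n]`
with `i ∈ I` and `σ⁻¹(i) = max_{k ∈ I} σ⁻¹(k)` equals `h^T_i · v^T_i`. -/
theorem weak_loday_coordinates (n : ℕ) (R : Rectangulation n)
    (hgen : R.Generic) (hlab : R.InorderLabeled)
    (σ : Equiv.Perm (Fin n)) (hσ : ∀ a b, R.PrecW a b → σ.symm a < σ.symm b)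
    (i : Fin n) :
    {I : Finset (Fin n) | IsInterval I ∧ i ∈ I ∧ ∀ k ∈ I, σ.symm k ≤ σ.symm i}.ncard =
      R.hT i * R.vT i := by
  have hn : 0 < n := i.pos
  have B := R.bst hgen hlab (fun a => ((σ.symm a : Fin n) : ℕ))
    (fun a b h => σ.symm.injective (Fin.ext h)) hn (by
      intro a b h
      refine hσ a b (Relation.TransGen.single ?_)
      rcases h with h | h
      · exact Or.inr (Or.inr (Or.inl h))
      · exact Or.inr (Or.inr (Or.inr h)))
  have hc := interval_count (fun a => ((σ.symm a : Fin n) : ℕ)) i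
  have e1 : {a | R.HSubT i a} = {a : Fin n | a < i ∧ ∀ k, a ≤ k → k ≤ i →
      ((σ.symm k : Fin n) : ℕ) ≤ ((σ.symm i : Fin n) : ℕ)} :=
    Set.ext fun a => B.left_iff i a
  have e2 : {a | R.VSubT i a} = {a : Fin n | i < a ∧ ∀ k, i ≤ k → k ≤ a →
      ((σ.symm k : Fin n) : ℕ) ≤ ((σ.symm i : Fin n) : ℕ)} :=
    Set.ext fun a => B.right_iff i a
  unfold Rectangulation.hT Rectangulation.vT
  rw [e1, e2]
  exact hc

end
end

section
/- Let R be a generic rectangulation of size n with source tree S = S(R), target tree T = T(R) and strong poset ≺_s^R, let σ be a permutation of [n] that is a linear extension of ≺_s^R (i.e., i ≺_s^R j implies σ^{-1}(i) < σ^{-1}(j)), and let i < j in [n]. Then the number of pairs (I,J) of nonempty consecutive intervals of [n] such that i ∈ I, j ∈ J, σ^{-1}(i) = max_{k∈I} σ^{-1}(k), σ^{-1}(j) = min_{k∈J} σ^{-1}(k), and σ^{-1}(i) > σ^{-1}(j), equals h^T_i · cv^{T,S}_{i,j} · h^S_j if j ≺_s^R i, and equals 0 otherwise. -/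
open Classical Pointwise

noncomputable section

namespace Rectangulation

variable {n : ℕ} (R : Rectangulation n)

theorem exists_right (F : Finset ℝ) (x : ℝ) (hx : x < 1) :
    ∃ x', x < x' ∧ x' ≤ 1 ∧ ∀ v ∈ F, v ≤ x' → v ≤ x := by
  induction F using Finset.induction_on with
  | empty => exact ⟨1, hx, le_refl _, by simp⟩
  | insert a s _ ih =>
    obtain ⟨x', h1, h2, h3⟩ := ih
    by_cases ha : a ≤ x
    · refine ⟨x', h1, h2, ?_⟩
      intro v hv hvx
      rcases Finset.mem_insert.1 hv with rfl | hv
      · exact ha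
      · exact h3 v hv hvx
    · push Not at ha
      refine ⟨min x' ((x + a) / 2), lt_min h1 (by linarith), (min_le_left _ _).trans h2, ?_⟩
      intro v hv hvx
      have hv1 := hvx.trans (min_le_left _ _)
      have hv2 := hvx.trans (min_le_right _ _)
      rcases Finset.mem_insert.1 hv with rfl | hv
      · linarith
      · exact h3 v hv hv1

theorem exists_left (F : Finset ℝ) (x : ℝ) (hx : 0 < x) :
    ∃ x', x' < x ∧ 0 ≤ x' ∧ ∀ v ∈ F, x' ≤ v → x ≤ v := by
  obtain ⟨x', h1, h2, h3⟩ := exists_right (F.image (fun v => 1 - v)) (1 - x) (by linarith)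
  refine ⟨1 - x', by linarith, by linarith, fun v hv hvx => ?_⟩
  have := h3 (1 - v) (Finset.mem_image_of_mem _ hv) (by linarith)
  linarith

theorem exists_up (f g : Fin n → ℝ) (x : ℝ) (h0 : 0 ≤ x) (hx : x < 1) :
    ∃ x', 0 ≤ x' ∧ x' ≤ 1 ∧ ∀ l, f l ≤ x' → x' ≤ g l → f l ≤ x ∧ x < g l := by
  obtain ⟨x', h1, h2, h3⟩ := exists_right (Finset.univ.image f) x hx
  exact ⟨x', by linarith, h2, fun l hl hl' =>
    ⟨h3 _ (Finset.mem_image_of_mem _ (Finset.mem_univ _)) hl, by linarith⟩⟩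

theorem exists_down (f g : Fin n → ℝ) (x : ℝ) (h0 : 0 < x) (hx : x ≤ 1) :
    ∃ x', 0 ≤ x' ∧ x' ≤ 1 ∧ ∀ l, f l ≤ x' → x' ≤ g l → f l < x ∧ x ≤ g l := by
  obtain ⟨x', h1, h2, h3⟩ := exists_left (Finset.univ.image g) x h0
  exact ⟨x', h2, by linarith, fun l hl hl' =>
    ⟨by linarith, h3 _ (Finset.mem_image_of_mem _ (Finset.mem_univ _)) hl'⟩⟩

theorem quadNE (x y : ℝ) (hx0 : 0 ≤ x) (hx1 : x < 1) (hy0 : 0 ≤ y) (hy1 : y < 1) :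
    ∃ l, R.xl l ≤ x ∧ x < R.xr l ∧ R.yb l ≤ y ∧ y < R.yt l := by
  obtain ⟨x', a1, a2, a3⟩ := exists_up R.xl R.xr x hx0 hx1
  obtain ⟨y', b1, b2, b3⟩ := exists_up R.yb R.yt y hy0 hy1
  obtain ⟨l, h1, h2, h3, h4⟩ := R.cover (x', y') a1 a2 b1 b2
  exact ⟨l, (a3 l h1 h2).1, (a3 l h1 h2).2, (b3 l h3 h4).1, (b3 l h3 h4).2⟩

theorem quadNW (x y : ℝ) (hx0 : 0 < x) (hx1 : x ≤ 1) (hy0 : 0 ≤ y) (hy1 : y < 1) :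
    ∃ l, R.xl l < x ∧ x ≤ R.xr l ∧ R.yb l ≤ y ∧ y < R.yt l := by
  obtain ⟨x', a1, a2, a3⟩ := exists_down R.xl R.xr x hx0 hx1
  obtain ⟨y', b1, b2, b3⟩ := exists_up R.yb R.yt y hy0 hy1
  obtain ⟨l, h1, h2, h3, h4⟩ := R.cover (x', y') a1 a2 b1 b2
  exact ⟨l, (a3 l h1 h2).1, (a3 l h1 h2).2, (b3 l h3 h4).1, (b3 l h3 h4).2⟩

theorem quadSE (x y : ℝ) (hx0 : 0 ≤ x) (hx1 : x < 1) (hy0 : 0 < y) (hy1 : y ≤ 1) :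
    ∃ l, R.xl l ≤ x ∧ x < R.xr l ∧ R.yb l < y ∧ y ≤ R.yt l := by
  obtain ⟨x', a1, a2, a3⟩ := exists_up R.xl R.xr x hx0 hx1
  obtain ⟨y', b1, b2, b3⟩ := exists_down R.yb R.yt y hy0 hy1
  obtain ⟨l, h1, h2, h3, h4⟩ := R.cover (x', y') a1 a2 b1 b2
  exact ⟨l, (a3 l h1 h2).1, (a3 l h1 h2).2, (b3 l h3 h4).1, (b3 l h3 h4).2⟩

theorem quadSW (x y : ℝ) (hx0 : 0 < x) (hx1 : x ≤ 1) (hy0 : 0 < y) (hy1 : y ≤ 1) :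
    ∃ l, R.xl l < x ∧ x ≤ R.xr l ∧ R.yb l < y ∧ y ≤ R.yt l := by
  obtain ⟨x', a1, a2, a3⟩ := exists_down R.xl R.xr x hx0 hx1
  obtain ⟨y', b1, b2, b3⟩ := exists_down R.yb R.yt y hy0 hy1
  obtain ⟨l, h1, h2, h3, h4⟩ := R.cover (x', y') a1 a2 b1 b2
  exact ⟨l, (a3 l h1 h2).1, (a3 l h1 h2).2, (b3 l h3 h4).1, (b3 l h3 h4).2⟩

theorem eq_of_overlap (i j : Fin n) (h1 : R.xl i < R.xr j) (h2 : R.xl j < R.xr i)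
    (h3 : R.yb i < R.yt j) (h4 : R.yb j < R.yt i) : i = j := by
  by_contra hne
  have hi := R.lt_x i
  have hj := R.lt_x j
  have hi' := R.lt_y i
  have hj' := R.lt_y j
  obtain ⟨x, hx1, hx2⟩ := exists_between (max_lt (lt_min hi h1) (lt_min h2 hj))
  obtain ⟨y, hy1, hy2⟩ := exists_between (max_lt (lt_min hi' h3) (lt_min h4 hj'))
  simp only [max_lt_iff, lt_min_iff] at hx1 hx2 hy1 hy2
  exact R.interiors_disjoint i j hne ⟨(x, y), ⟨hx1.1, hx2.1, hy1.1, hy2.1⟩,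
    ⟨hx1.2, hx2.2, hy1.2, hy2.2⟩⟩

/-- transposed rectangulation -/
def tr : Rectangulation n where
  xl := R.yb
  xr := R.yt
  yb := R.xl
  yt := R.xr
  lt_x := R.lt_y
  lt_y := R.lt_x
  xl_nonneg := R.yb_nonneg
  xr_le_one := R.yt_le_one
  yb_nonneg := R.xl_nonneg
  yt_le_one := R.xr_le_one
  interiors_disjoint := by
    rintro i j hne ⟨p, ⟨a1, a2, a3, a4⟩, ⟨b1, b2, b3, b4⟩⟩
    exact R.interiors_disjoint i j hne ⟨(p.2, p.1), ⟨a3, a4, a1, a2⟩, ⟨b3, b4, b1, b2⟩⟩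
  cover := by
    intro p h1 h2 h3 h4
    obtain ⟨i, a, b, c, d⟩ := R.cover (p.2, p.1) h3 h4 h1 h2
    exact ⟨i, c, d, a, b⟩

/-- rectangulation rotated by a half turn -/
def rot : Rectangulation n where
  xl i := 1 - R.xr i
  xr i := 1 - R.xl i
  yb i := 1 - R.yt i
  yt i := 1 - R.yb i
  lt_x i := by have := R.lt_x i; linarith
  lt_y i := by have := R.lt_y i; linarith
  xl_nonneg i := by have := R.xr_le_one i; linarith
  xr_le_one i := by have := R.xl_nonneg i; linarith
  yb_nonneg i := by have := R.yt_le_one i; linarith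
  yt_le_one i := by have := R.yb_nonneg i; linarith
  interiors_disjoint := by
    rintro i j hne ⟨p, ⟨a1, a2, a3, a4⟩, ⟨b1, b2, b3, b4⟩⟩
    exact R.interiors_disjoint i j hne ⟨(1 - p.1, 1 - p.2),
      ⟨by simp only; linarith, by simp only; linarith, by simp only; linarith, by simp only; linarith⟩,
      ⟨by simp only; linarith, by simp only; linarith, by simp only; linarith, by simp only; linarith⟩⟩
  cover := by
    intro p h1 h2 h3 h4
    obtain ⟨i, a, b, c, d⟩ := R.cover (1 - p.1, 1 - p.2) (by simp only; linarith)
      (by simp only; linarith) (by simp only; linarith) (by simp only; linarith)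
    simp only at a b c d
    exact ⟨i, by linarith, by linarith, by linarith, by linarith⟩

/-- `j` right of `i` along a common segment, combinatorial form. -/
def DR (j i : Fin n) : Prop :=
  R.xl j = R.xr i ∧ ∀ m, R.xl m < R.xl j → R.xl j < R.xr m →
    (R.yt m ≤ R.yb i ∧ R.yt m ≤ R.yb j) ∨ (R.yt i ≤ R.yb m ∧ R.yt j ≤ R.yb m)

/-- `i` above `j` along a common segment, combinatorial form. -/
def DA (i j : Fin n) : Prop :=
  R.yb i = R.yt j ∧ ∀ m, R.yb m < R.yb i → R.yb i < R.yt m →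
    (R.xr m ≤ R.xl j ∧ R.xr m ≤ R.xl i) ∨ (R.xr j ≤ R.xl m ∧ R.xr i ≤ R.xl m)

theorem tr_DR (i j : Fin n) : R.tr.DR i j ↔ R.DA i j := Iff.rfl
theorem tr_DA (i j : Fin n) : R.tr.DA i j ↔ R.DR i j := Iff.rfl

theorem rot_DR (i j : Fin n) : R.rot.DR i j ↔ R.DR j i := by
  unfold DR
  constructor
  · rintro ⟨h, h'⟩
    refine ⟨by simp only [rot] at h; linarith, fun m h1 h2 => ?_⟩
    have := h' m (by simp only [rot] at h ⊢; linarith) (by simp only [rot] at h ⊢; linarith)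
    simp only [rot, sub_le_sub_iff_left] at this
    tauto
  · rintro ⟨h, h'⟩
    refine ⟨by simp only [rot]; linarith, fun m h1 h2 => ?_⟩
    simp only [rot] at h1 h2
    have := h' m (by linarith) (by linarith)
    simp only [rot, sub_le_sub_iff_left]
    tauto

theorem rot_DA (i j : Fin n) : R.rot.DA i j ↔ R.DA j i := R.tr.rot_DR i j

theorem tr_TEdgeH (i j : Fin n) : R.tr.TEdgeH i j ↔ R.TEdgeV i j := by
  simp only [TEdgeH, TEdgeV, tr]; tauto
theorem tr_TEdgeV (i j : Fin n) : R.tr.TEdgeV i j ↔ R.TEdgeH i j := by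
  simp only [TEdgeH, TEdgeV, tr]; tauto
theorem tr_SEdgeH (i j : Fin n) : R.tr.SEdgeH i j ↔ R.SEdgeV i j := by
  simp only [SEdgeH, SEdgeV, tr]; tauto
theorem tr_SEdgeV (i j : Fin n) : R.tr.SEdgeV i j ↔ R.SEdgeH i j := by
  simp only [SEdgeH, SEdgeV, tr]; tauto
theorem rot_TEdgeH (i j : Fin n) : R.rot.TEdgeH i j ↔ R.SEdgeH j i := by
  simp only [TEdgeH, SEdgeH, rot, sub_right_inj]
theorem rot_TEdgeV (i j : Fin n) : R.rot.TEdgeV i j ↔ R.SEdgeV j i := by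
  simp only [TEdgeV, SEdgeV, rot, sub_right_inj]
theorem rot_SEdgeH (i j : Fin n) : R.rot.SEdgeH i j ↔ R.TEdgeH j i := by
  simp only [TEdgeH, SEdgeH, rot, sub_right_inj]
theorem rot_SEdgeV (i j : Fin n) : R.rot.SEdgeV i j ↔ R.TEdgeV j i := by
  simp only [TEdgeV, SEdgeV, rot, sub_right_inj]

theorem tr_corner (i : Fin n) (p : ℝ × ℝ) : R.tr.IsCorner i p ↔ R.IsCorner i (p.2, p.1) := by
  simp only [IsCorner, tr]; tauto
theorem rot_corner (i : Fin n) (p : ℝ × ℝ) :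
    R.rot.IsCorner i p ↔ R.IsCorner i (1 - p.1, 1 - p.2) := by
  have key : ∀ a b : ℝ, a = 1 - b ↔ 1 - a = b := fun a b =>
    ⟨fun h => by linarith, fun h => by linarith⟩
  simp only [IsCorner, rot, key]; tauto

theorem tr_generic (h : R.Generic) : R.tr.Generic := by
  rintro ⟨p, i, j, k, l, h1, h2, h3, h4, h5, h6, a, b, c, d⟩
  rw [tr_corner] at a b c d
  exact h ⟨_, i, j, k, l, h1, h2, h3, h4, h5, h6, a, b, c, d⟩
theorem rot_generic (h : R.Generic) : R.rot.Generic := by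
  rintro ⟨p, i, j, k, l, h1, h2, h3, h4, h5, h6, a, b, c, d⟩
  rw [rot_corner] at a b c d
  exact h ⟨_, i, j, k, l, h1, h2, h3, h4, h5, h6, a, b, c, d⟩

theorem tr_TVLeaf (i : Fin n) : R.tr.TVLeaf i ↔ R.THLeaf i := by
  simp only [TVLeaf, THLeaf, tr_TEdgeV]
theorem tr_SVLeaf (i : Fin n) : R.tr.SVLeaf i ↔ R.SHLeaf i := by
  simp only [SVLeaf, SHLeaf, tr_SEdgeV]
theorem rot_TVLeaf (i : Fin n) : R.rot.TVLeaf i ↔ R.SVLeaf i := by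
  simp only [TVLeaf, SVLeaf, rot_TEdgeV]
theorem rot_SVLeaf (i : Fin n) : R.rot.SVLeaf i ↔ R.TVLeaf i := by
  simp only [TVLeaf, SVLeaf, rot_SEdgeV]
theorem rot_THLeaf (i : Fin n) : R.rot.THLeaf i ↔ R.SHLeaf i := by
  simp only [THLeaf, SHLeaf, rot_TEdgeH]
theorem rot_SHLeaf (i : Fin n) : R.rot.SHLeaf i ↔ R.THLeaf i := by
  simp only [THLeaf, SHLeaf, rot_SEdgeH]

theorem dirRightOf_iff (j i : Fin n) : R.DirRightOf j i ↔ R.DR j i := by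
  have hj := R.lt_y j
  have hi := R.lt_y i
  constructor
  · rintro ⟨h, h0, h1, h2⟩
    refine ⟨h, fun m a b => ?_⟩
    by_contra hcon
    have hm := R.lt_y m
    have : max (R.yb m) (min (R.yb j) (R.yb i)) < min (R.yt m) (max (R.yt j) (R.yt i)) := by
      simp only [max_lt_iff, lt_min_iff, lt_max_iff, min_lt_iff]
      grind
    obtain ⟨y, hy1, hy2⟩ := exists_between this
    rw [max_lt_iff] at hy1
    rw [lt_min_iff] at hy2
    obtain ⟨l, hl1, hl2, hl3⟩ := h2 y hy1.2.le hy2.2.le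
    simp only at hl1 hl2 hl3
    have hl := R.lt_x l
    have : l = m := R.eq_of_overlap l m (by grind) (by grind) (by grind) (by grind)
    grind
  · rintro ⟨h, h2⟩
    have q1 := R.lt_x j
    have q2 := R.lt_x i
    have q3 := R.xr_le_one j
    have q4 := R.xl_nonneg i
    refine ⟨h, by linarith, by linarith, fun y hy1 hy2 => ?_⟩
    rw [min_le_iff] at hy1
    rw [le_max_iff] at hy2
    have w1 := R.yb_nonneg j
    have w2 := R.yb_nonneg i
    have w3 := R.yt_le_one j
    have w4 := R.yt_le_one i
    by_cases hlt : y < max (R.yt j) (R.yt i)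
    · rw [lt_max_iff] at hlt
      obtain ⟨l, a, b, c, d⟩ := R.quadNE (R.xl j) y (by linarith) (by linarith) (by grind) (by grind)
      have := h2 l
      exact ⟨l, Or.inl (by grind), c, d.le⟩
    · push Not at hlt
      rw [max_le_iff] at hlt
      obtain ⟨l, a, b, c, d⟩ := R.quadSE (R.xl j) y (by linarith) (by linarith) (by grind) (by grind)
      have := h2 l
      exact ⟨l, Or.inl (by grind), c.le, d⟩

theorem tr_onH (p : ℝ × ℝ) : R.tr.OnVertEdge p ↔ R.OnHorizEdge (p.2, p.1) := by
  simp only [OnVertEdge, OnHorizEdge, tr]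

theorem dirAbove_iff (i j : Fin n) : R.DirAbove i j ↔ R.DA i j := by
  rw [← tr_DR, ← dirRightOf_iff]
  simp only [DirRightOf, DirAbove, SameVSeg, SameHSeg, tr_onH]
  rfl

/-- common vertical leaf -/
def CV (a c : Fin n) : Prop := R.TVLeaf a ∧ R.SVLeaf c ∧ R.DR c a
/-- common horizontal leaf -/
def CH (a c : Fin n) : Prop := R.THLeaf a ∧ R.SHLeaf c ∧ R.DA c a

theorem commonV_iff (a c : Fin n) : R.CommonVLeaf a c ↔ R.CV a c := by
  rw [CV, ← dirRightOf_iff, CommonVLeaf, DirRightOf]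
  constructor
  · rintro ⟨h1, h2, h3, h4⟩
    refine ⟨h1, h2, h3.symm, ?_⟩
    rw [← h3]
    simpa only [SameVSeg, min_comm, max_comm] using h4
  · rintro ⟨h1, h2, h3, h4⟩
    refine ⟨h1, h2, h3.symm, ?_⟩
    rw [← h3]
    simpa only [SameVSeg, min_comm, max_comm] using h4

theorem commonH_iff (a c : Fin n) : R.CommonHLeaf a c ↔ R.CH a c := by
  rw [CH, ← dirAbove_iff, CommonHLeaf, DirAbove]
  constructor
  · rintro ⟨h1, h2, h3, h4⟩
    refine ⟨h1, h2, h3.symm, ?_⟩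
    rw [← h3]
    simpa only [SameHSeg, min_comm, max_comm] using h4
  · rintro ⟨h1, h2, h3, h4⟩
    refine ⟨h1, h2, h3.symm, ?_⟩
    rw [← h3]
    simpa only [SameHSeg, min_comm, max_comm] using h4

theorem tr_CV (a c : Fin n) : R.tr.CV a c ↔ R.CH a c := by
  simp only [CV, CH, tr_TVLeaf, tr_SVLeaf, tr_DR]
theorem rot_CV (a c : Fin n) : R.rot.CV a c ↔ R.CV c a := by
  simp only [CV, rot_TVLeaf, rot_SVLeaf, rot_DR]; tauto
theorem rot_CH (a c : Fin n) : R.rot.CH a c ↔ R.CH c a := by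
  simp only [CH, rot_THLeaf, rot_SHLeaf, rot_DA]; tauto

theorem cross_right (m i : Fin n) (h1 : R.xl m < R.xr i) (h2 : R.xr i < R.xr m) :
    R.yt m ≤ R.yb i ∨ R.yt i ≤ R.yb m := by
  by_contra hcon
  push Not at hcon
  have := R.eq_of_overlap m i h1 ((R.lt_x i).trans h2) hcon.2 hcon.1
  subst this
  exact lt_irrefl _ h2

theorem cross_left (m i : Fin n) (h1 : R.xl m < R.xl i) (h2 : R.xl i < R.xr m) :
    R.yt m ≤ R.yb i ∨ R.yt i ≤ R.yb m := by
  by_contra hcon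
  push Not at hcon
  have := R.eq_of_overlap m i (h1.trans (R.lt_x i)) h2 hcon.2 hcon.1
  subst this
  exact lt_irrefl _ h1

theorem DR_of_TEdgeH {r q : Fin n} (h : R.TEdgeH r q) : R.DR q r := by
  obtain ⟨h1, h2⟩ := h
  refine ⟨h1, fun m a b => ?_⟩
  have c1 := R.cross_left m q a b
  have c2 := R.cross_right m r (by linarith) (by linarith)
  have := R.lt_y r
  have := R.lt_y q
  have := R.lt_y m
  grind

theorem DA_of_TEdgeV {r q : Fin n} (h : R.TEdgeV r q) : R.DA q r := by
  rw [← tr_TEdgeH] at h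
  exact R.tr.DR_of_TEdgeH h

theorem DR_of_SEdgeH {r q : Fin n} (h : R.SEdgeH q r) : R.DR r q := by
  rw [← rot_TEdgeH] at h
  exact (R.rot_DR _ _).1 (R.rot.DR_of_TEdgeH h)

theorem DA_of_SEdgeV {r q : Fin n} (h : R.SEdgeV q r) : R.DA r q := by
  rw [← rot_TEdgeV] at h
  exact (R.rot_DA _ _).1 (R.rot.DA_of_TEdgeV h)

theorem Adj_of_TEdgeH {r q : Fin n} (h : R.TEdgeH r q) : R.AdjStep r q := by
  obtain ⟨h1, h2⟩ := h
  refine Or.inl ⟨h1.symm, ?_⟩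
  have := R.lt_y r
  have := R.lt_y q
  simp only [max_lt_iff, lt_min_iff]
  grind

theorem tr_Adj (i j : Fin n) : R.tr.AdjStep i j ↔ R.AdjStep i j := by
  simp only [AdjStep, tr]; tauto

theorem rot_Adj (i j : Fin n) : R.rot.AdjStep i j ↔ R.AdjStep j i := by
  simp only [AdjStep, rot, max_lt_iff, lt_min_iff, sub_lt_sub_iff_left, sub_right_inj]
  have e1 : R.xl i = R.xr j ↔ R.xr j = R.xl i := eq_comm
  have e2 : R.yb i = R.yt j ↔ R.yt j = R.yb i := eq_comm
  tauto

theorem Adj_of_TEdgeV {r q : Fin n} (h : R.TEdgeV r q) : R.AdjStep r q := by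
  rw [← tr_TEdgeH] at h
  exact (R.tr_Adj _ _).1 (R.tr.Adj_of_TEdgeH h)

theorem wf_yt : WellFounded (fun a b : Fin n => R.yt b < R.yt a) := by
  have : IsTrans (Fin n) (fun a b : Fin n => R.yt b < R.yt a) := ⟨fun a b c h1 h2 => h2.trans h1⟩
  have : Std.Irrefl (fun a b : Fin n => R.yt b < R.yt a) := ⟨fun a => lt_irrefl _⟩
  exact Finite.wellFounded_of_trans_of_irrefl _

theorem wf_yt' : WellFounded (fun a b : Fin n => R.yt a < R.yt b) := by
  have : IsTrans (Fin n) (fun a b : Fin n => R.yt a < R.yt b) := ⟨fun a b c h1 h2 => h1.trans h2⟩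
  have : Std.Irrefl (fun a b : Fin n => R.yt a < R.yt b) := ⟨fun a => lt_irrefl _⟩
  exact Finite.wellFounded_of_trans_of_irrefl _

theorem stack_or (i i' : Fin n) (hx : R.xr i = R.xr i') :
    i = i' ∨ R.yt i ≤ R.yb i' ∨ R.yt i' ≤ R.yb i := by
  by_contra hcon
  push Not at hcon
  have := R.lt_x i
  have := R.lt_x i'
  exact hcon.1 (R.eq_of_overlap i i' (by linarith) (by linarith) hcon.2.2 hcon.2.1)

/-- Left rectangles along a vertical segment are chained by vertical target tree edges. -/
theorem stack (i' i : Fin n) (hx : R.xr i = R.xr i') (hy : R.yt i ≤ R.yb i')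
    (hc : ∀ m, R.xl m < R.xr i → R.xr i < R.xr m → R.yt m ≤ R.yb i ∨ R.yt i' ≤ R.yb m) :
    Relation.ReflTransGen R.TEdgeV i i' := by
  induction i using (R.wf_yt).induction with
  | _ i ih =>
    have b1 := R.lt_y i
    have b2 := R.lt_y i'
    have b3 := R.lt_x i
    have b4 := R.xl_nonneg i
    have b5 := R.xr_le_one i
    have b6 := R.yb_nonneg i
    have b7 := R.yt_le_one i'
    obtain ⟨l, l1, l2, l3, l4⟩ := R.quadNW (R.xr i) (R.yt i) (by linarith) b5 (by linarith)
      (by linarith)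
    have hlx : R.xr l = R.xr i := by
      by_contra hne
      have := hc l l1 (lt_of_le_of_ne l2 (Ne.symm hne))
      grind
    have hly : R.yb l = R.yt i := by
      rcases R.stack_or l i hlx with h | h | h
      · subst h; linarith
      · linarith
      · linarith
    have e : R.TEdgeV i l := ⟨hlx, hly⟩
    rcases R.stack_or l i' (hlx.trans hx) with h | h | h
    · subst h; exact Relation.ReflTransGen.single e
    · refine Relation.ReflTransGen.head e (ih l l4 (hlx.trans hx) h ?_)
      intro m m1 m2
      rw [hlx] at m1 m2
      have := hc m m1 m2
      have := R.cross_right m l (by linarith) (by linarith)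
      have := R.lt_y l
      have := R.lt_y m
      grind
    · linarith

theorem chain_clear {a i : Fin n} (h : Relation.ReflTransGen R.TEdgeV a i) :
    R.xr a = R.xr i ∧ R.yb a ≤ R.yb i ∧ R.yt a ≤ R.yt i ∧
    ∀ m, R.xl m < R.xr i → R.xr i < R.xr m → R.yt m ≤ R.yb a ∨ R.yt i ≤ R.yb m := by
  induction h with
  | refl => exact ⟨rfl, le_refl _, le_refl _, fun m => R.cross_right m a⟩
  | @tail b c _ e ih =>
    obtain ⟨h1, h2, h3, h4⟩ := ih
    obtain ⟨e1, e2⟩ := e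
    have := R.lt_y b
    have := R.lt_y c
    refine ⟨by linarith, by linarith, by linarith, fun m m1 m2 => ?_⟩
    have := h4 m (by linarith) (by linarith)
    have := R.cross_right m c m1 m2
    have := R.lt_y m
    grind

theorem exists_TVLeaf (i : Fin n) : ∃ a, R.TVLeaf a ∧ Relation.ReflTransGen R.TEdgeV a i := by
  induction i using (R.wf_yt').induction with
  | _ i ih =>
    by_cases h : R.TVLeaf i
    · exact ⟨i, h, Relation.ReflTransGen.refl⟩
    · obtain ⟨r, hr⟩ : ∃ r, R.TEdgeV r i := not_not.1 h
      have := R.lt_y i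
      obtain ⟨a, h1, h2⟩ := ih r (by have := hr.2; linarith)
      exact ⟨a, h1, h2.tail hr⟩

/-- A bottommost left rectangle is the start of a chain to any left rectangle of the segment. -/
theorem leaf_chain (a i c : Fin n) (ha : R.TVLeaf a) (h1 : R.DR c a) (h2 : R.DR c i) :
    Relation.ReflTransGen R.TEdgeV a i := by
  obtain ⟨x1, h1⟩ := h1
  obtain ⟨x2, h2⟩ := h2
  have hc := R.lt_y c
  rcases R.stack_or a i (by linarith) with h | h | h
  · subst h; exact Relation.ReflTransGen.refl
  · refine R.stack i a (by linarith) h (fun m m1 m2 => ?_)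
    have := h1 m (by linarith) (by linarith)
    have := h2 m (by linarith) (by linarith)
    have := R.lt_y m
    grind
  · have hch := R.stack a i (by linarith) h (fun m m1 m2 => by
      have := h1 m (by linarith) (by linarith)
      have := h2 m (by linarith) (by linarith)
      have := R.lt_y m
      grind)
    rcases Relation.ReflTransGen.cases_tail hch with h' | ⟨r, _, hr⟩
    · subst h'; exact Relation.ReflTransGen.refl
    · exact absurd ⟨r, hr⟩ ha

theorem topLeft (c : Fin n) (hc : R.SVLeaf c) (h0 : 0 < R.xl c) : ∃ a, R.TEdgeH a c := by
  have b1 := R.lt_y c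
  have b2 := R.lt_x c
  have b3 := R.yb_nonneg c
  have b4 := R.yt_le_one c
  have b5 := R.xr_le_one c
  obtain ⟨a, a1, a2, a3, a4⟩ := R.quadSW (R.xl c) (R.yt c) h0 (by linarith) (by linarith) b4
  have hax : R.xr a = R.xl c := by
    by_contra hne
    have := R.eq_of_overlap a c (by linarith) (lt_of_le_of_ne a2 (Ne.symm hne)) a3 (by linarith)
    subst this
    exact lt_irrefl _ a1
  refine ⟨a, hax.symm, ?_⟩
  by_contra hne
  have hlt : R.yt c < R.yt a := lt_of_le_of_ne a4 hne
  have := R.yt_le_one a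
  obtain ⟨l, l1, l2, l3, l4⟩ := R.quadNE (R.xl c) (R.yt c) h0.le (by linarith) (by linarith)
    (by linarith)
  have hlx : R.xl l = R.xl c := by
    by_contra hne
    have hh := lt_of_le_of_ne l1 hne
    have := R.eq_of_overlap l a (by linarith) (by linarith) (by linarith) (by linarith)
    subst this
    linarith
  have hly : R.yb l = R.yt c := by
    by_contra hne
    have hh := lt_of_le_of_ne l3 hne
    have := R.eq_of_overlap l c (by linarith) (by linarith) (by linarith) (by linarith)
    subst this
    linarith
  exact hc ⟨l, hlx.symm, hly.symm⟩

theorem bottomRight (a : Fin n) (ha : R.TVLeaf a) (h1 : R.xr a < 1) : ∃ c, R.SEdgeH a c := by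
  obtain ⟨c, hc⟩ := R.rot.topLeft a ((R.rot_SVLeaf a).2 ha) (by simp only [rot]; linarith)
  exact ⟨c, (R.rot_TEdgeH _ _).1 hc⟩

theorem TEdgeV_of_corner (i j : Fin n) (hx : R.xr i = R.xl j) (hy : R.yb i = R.yt j) :
    ∃ m, R.TEdgeV m i ∧ R.TEdgeH m j := by
  have b1 := R.lt_y j
  have b2 := R.lt_x i
  have b3 := R.yb_nonneg j
  have b4 := R.yt_le_one j
  have b5 := R.xr_le_one i
  have b6 := R.xl_nonneg i
  have b7 := R.lt_x j
  have b8 := R.lt_y i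
  obtain ⟨a, a1, a2, a3, a4⟩ := R.quadSW (R.xl j) (R.yt j) (by linarith) (by linarith)
    (by linarith) b4
  have hax : R.xr a = R.xl j := by
    by_contra hne
    have := R.eq_of_overlap a j (by linarith) (lt_of_le_of_ne a2 (Ne.symm hne)) a3 (by linarith)
    subst this
    exact lt_irrefl _ a1
  have hay : R.yt a = R.yt j := by
    by_contra hne
    have hh := lt_of_le_of_ne a4 (Ne.symm hne)
    have := R.eq_of_overlap a i (by linarith) (by linarith) (by linarith) (by linarith)
    subst this
    linarith
  exact ⟨a, ⟨by linarith, by linarith⟩, ⟨by linarith, by linarith⟩⟩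

section generic
variable (hgen : R.Generic)
include hgen

theorem no_four (a q q' : Fin n) (h : R.TEdgeH a q) (h' : R.TEdgeV a q') : False := by
  obtain ⟨h1, h2⟩ := h
  obtain ⟨g1, g2⟩ := h'
  have := R.lt_y a
  have := R.lt_x a
  have := R.lt_y q
  have := R.lt_x q
  have := R.lt_y q'
  have := R.lt_x q'
  have := R.yb_nonneg a
  have := R.xl_nonneg a
  have := R.xr_le_one q
  have := R.yt_le_one q'
  obtain ⟨l, l1, l2, l3, l4⟩ := R.quadNE (R.xr a) (R.yt a) (by linarith) (by linarith)
    (by linarith) (by linarith)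
  have hlx : R.xl l = R.xr a := by
    by_contra hne
    have hh := lt_of_le_of_ne l1 hne
    have := R.eq_of_overlap l q' (by linarith) (by linarith) (by linarith) (by linarith)
    subst this
    linarith
  have hly : R.yb l = R.yt a := by
    by_contra hne
    have hh := lt_of_le_of_ne l3 hne
    have := R.eq_of_overlap l q (by linarith) (by linarith) (by linarith) (by linarith)
    subst this
    linarith
  refine hgen ⟨(R.xr a, R.yt a), a, q, q', l, ?_, ?_, ?_, ?_, ?_, ?_, ?_, ?_, ?_, ?_⟩
  · rintro rfl; linarith
  · rintro rfl; linarith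
  · rintro rfl; linarith
  · rintro rfl; linarith
  · rintro rfl; linarith
  · rintro rfl; linarith
  · exact ⟨Or.inr rfl, Or.inr rfl⟩
  · exact ⟨Or.inl h1.symm, Or.inr h2.symm⟩
  · exact ⟨Or.inr g1.symm, Or.inl g2.symm⟩
  · exact ⟨Or.inl hlx.symm, Or.inl hly.symm⟩

omit hgen in
theorem TEdgeH_unique (a q q' : Fin n) (h : R.TEdgeH a q) (h' : R.TEdgeH a q') : q = q' := by
  obtain ⟨h1, h2⟩ := h
  obtain ⟨g1, g2⟩ := h'
  have := R.lt_y q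
  have := R.lt_x q
  have := R.lt_y q'
  have := R.lt_x q'
  exact R.eq_of_overlap q q' (by linarith) (by linarith) (by linarith) (by linarith)

theorem parent_unique (a q q' : Fin n) (h : R.TEdgeH a q ∨ R.TEdgeV a q)
    (h' : R.TEdgeH a q' ∨ R.TEdgeV a q') : q = q' := by
  rcases h with h | h <;> rcases h' with h' | h'
  · exact R.TEdgeH_unique a q q' h h'
  · exact (R.no_four hgen a q q' h h').elim
  · exact (R.no_four hgen a q' q h' h).elim
  · rw [← tr_TEdgeH] at h h'
    exact R.tr.TEdgeH_unique a q q' h h'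

theorem SVLeaf_of_TEdgeH (a c : Fin n) (h : R.TEdgeH a c) : R.SVLeaf c := by
  rintro ⟨l, e1, e2⟩
  obtain ⟨h1, h2⟩ := h
  have := R.lt_y a
  have := R.lt_x a
  have := R.lt_y l
  have := R.lt_x l
  have := R.yb_nonneg a
  have := R.xl_nonneg a
  have := R.xr_le_one a
  have := R.yt_le_one l
  obtain ⟨m, m1, m2, m3, m4⟩ := R.quadNW (R.xr a) (R.yt a) (by linarith) (by linarith)
    (by linarith) (by linarith)
  have hmx : R.xr m = R.xr a := by
    by_contra hne
    have hh := lt_of_le_of_ne m2 (Ne.symm hne)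
    have := R.eq_of_overlap m l (by linarith) (by linarith) (by linarith) (by linarith)
    subst this
    linarith
  have hmy : R.yb m = R.yt a := by
    by_contra hne
    have hh := lt_of_le_of_ne m3 hne
    have := R.eq_of_overlap m a (by linarith) (by linarith) (by linarith) (by linarith)
    subst this
    linarith
  exact R.no_four hgen a c m ⟨h1, h2⟩ ⟨hmx, hmy⟩

end generic

/-- labelings -/
structure Lab (R : Rectangulation n) (ℓ : Fin n → ℤ) : Prop where
  right : ∀ i j, R.DR j i → ℓ i < ℓ j
  above : ∀ i j, R.DA i j → ℓ i < ℓ j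
  step : ∀ i j, ℓ j = ℓ i + 1 → R.DR j i ∨ R.DA i j
  inj : Function.Injective ℓ
  conv : ∀ i j k, ℓ i ≤ k → k ≤ ℓ j → ∃ m, ℓ m = k

theorem Lab.tr {R : Rectangulation n} {ℓ : Fin n → ℤ} (h : Lab R ℓ) :
    Lab R.tr (fun i => - ℓ i) where
  right i j hij := by have := h.above j i hij; linarith
  above i j hij := by have := h.right j i hij; linarith
  step i j hij := (h.step j i (by linarith)).symm
  inj i j hij := h.inj (neg_injective hij)
  conv i j k h1 h2 := by
    obtain ⟨m, hm⟩ := h.conv j i (-k) (by linarith) (by linarith)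
    exact ⟨m, by linarith⟩

theorem Lab.rot {R : Rectangulation n} {ℓ : Fin n → ℤ} (h : Lab R ℓ) :
    Lab R.rot (fun i => - ℓ i) where
  right i j hij := by have := h.right j i ((R.rot_DR _ _).1 hij); linarith
  above i j hij := by have := h.above j i ((R.rot_DA _ _).1 hij); linarith
  step i j hij := by
    rw [rot_DR, rot_DA]; exact h.step j i (by linarith)
  inj i j hij := h.inj (neg_injective hij)
  conv i j k h1 h2 := by
    obtain ⟨m, hm⟩ := h.conv j i (-k) (by linarith) (by linarith)
    exact ⟨m, by linarith⟩

section lab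
variable (hgen : R.Generic) (ℓ : Fin n → ℤ) (hl : Lab R ℓ)
include hl

theorem chain_le {a i : Fin n} (h : Relation.ReflTransGen R.TEdgeV a i) : ℓ i ≤ ℓ a := by
  induction h with
  | refl => exact le_refl _
  | tail _ e ih => exact (hl.above _ _ (R.DA_of_TEdgeV e)).le.trans ih

theorem gapV (b c : Fin n) (h : ℓ c = ℓ b + 1) (hd : R.DR c b) : R.CV b c := by
  refine ⟨?_, ?_, hd⟩
  · rintro ⟨r, hr⟩
    have h1 := hl.above _ _ (R.DA_of_TEdgeV hr)
    have : R.DR c r := by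
      obtain ⟨e1, e2⟩ := hr
      obtain ⟨d1, d2⟩ := hd
      refine ⟨by linarith, fun m m1 m2 => ?_⟩
      have := d2 m m1 m2
      have := R.cross_right m r (by linarith) (by linarith)
      have := R.lt_y r
      have := R.lt_y m
      have := R.lt_y b
      grind
    have h2 := hl.right _ _ this
    linarith
  · rintro ⟨r, hr⟩
    have h1 := hl.above _ _ (R.DA_of_SEdgeV hr)
    have : R.DR r b := by
      obtain ⟨e1, e2⟩ := hr
      obtain ⟨d1, d2⟩ := hd
      refine ⟨by linarith, fun m m1 m2 => ?_⟩
      have := d2 m (by linarith) (by linarith)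
      have := R.cross_left m r (by linarith) (by linarith)
      have := R.lt_y r
      have := R.lt_y m
      have := R.lt_y c
      grind
    have h2 := hl.right _ _ this
    linarith

/-- two right rectangles of the same segment, the second one topmost -/
theorem right_le (k c a : Fin n) (hc : R.SVLeaf c) (h1 : R.DR c a) (h2 : R.DR k a) :
    ℓ c ≤ ℓ k := by
  have := R.rot.leaf_chain c k a ((R.rot_TVLeaf c).2 hc) ((R.rot_DR _ _).2 h1)
    ((R.rot_DR _ _).2 h2)
  have := R.rot.chain_le _ hl.rot this
  linarith

theorem segGapV (a c : Fin n) (h : R.CV a c) : ℓ c = ℓ a + 1 := by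
  obtain ⟨ha, hc, hd⟩ := h
  have hac := hl.right _ _ hd
  by_contra hne
  obtain ⟨k, hk⟩ := hl.conv a c (ℓ a + 1) (by linarith) (by linarith)
  have hkc : ℓ k < ℓ c := by rw [hk]; exact lt_of_le_of_ne hac (Ne.symm hne)
  rcases hl.step a k hk with h | h
  · have := R.right_le ℓ hl k c a hc hd h
    linarith
  · have b1 := hd.1
    have b2 := R.lt_x c
    have b3 := R.xr_le_one c
    obtain ⟨c', hc'⟩ := R.bottomRight a ha (by linarith)
    have h1 := R.right_le ℓ hl c' c a hc hd (R.DR_of_SEdgeH hc')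
    have : R.DA c' k := by
      obtain ⟨e1, e2⟩ := hc'
      obtain ⟨d1, d2⟩ := h
      refine ⟨by linarith, fun m m1 m2 => ?_⟩
      have := d2 m (by linarith) (by linarith)
      have := R.tr.cross_left m c' m1 m2
      have := R.lt_x m
      have := R.lt_x a
      have := R.lt_x c'
      simp only [Rectangulation.tr] at *
      grind
    have h2 := hl.above _ _ this
    linarith

theorem segGapH (a c : Fin n) (h : R.CH a c) : ℓ a = ℓ c + 1 := by
  have := R.tr.segGapV _ hl.tr a c ((R.tr_CV _ _).2 h)
  linarith

theorem gap (b c : Fin n) (h : ℓ c = ℓ b + 1) : R.CV b c ∨ R.CH c b := by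
  rcases hl.step b c h with h1 | h1
  · exact Or.inl (R.gapV ℓ hl b c h h1)
  · right
    rw [← tr_CV]
    exact R.tr.gapV _ hl.tr c b (by linarith) h1

omit hl in
theorem CV_chain (b c : Fin n) (h : R.CV b c) :
    ∃ a, Relation.ReflTransGen R.TEdgeV b a ∧ R.TEdgeH a c := by
  obtain ⟨h1, h2, h3⟩ := h
  have := h3.1
  have := R.lt_x b
  have := R.xl_nonneg b
  obtain ⟨a, ha⟩ := R.topLeft c h2 (by linarith)
  exact ⟨a, R.leaf_chain b a c h1 h3 (R.DR_of_TEdgeH ha), ha⟩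

omit hl in
theorem chain_TReach {b a : Fin n} (h : Relation.ReflTransGen R.TEdgeV b a) : R.TReach b a :=
  Relation.ReflTransGen.mono (fun _ _ h => Or.inr h) _ _ h

omit hl in
theorem CV_HSubT (b c : Fin n) (h : R.CV b c) : R.HSubT c b := by
  obtain ⟨a, h1, h2⟩ := R.CV_chain b c h
  exact ⟨a, h2, R.chain_TReach h1⟩

omit hl in
theorem tr_TReach (a b : Fin n) : R.tr.TReach a b ↔ R.TReach a b := by
  have : (fun a b => R.tr.TEdgeH a b ∨ R.tr.TEdgeV a b) =
      (fun a b => R.TEdgeH a b ∨ R.TEdgeV a b) := by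
    funext a b
    rw [tr_TEdgeH, tr_TEdgeV, or_comm]
  unfold TReach
  rw [this]

omit hl in
theorem rot_TReach (a b : Fin n) : R.rot.TReach a b ↔ R.SReach b a := by
  have : (fun a b => R.rot.TEdgeH a b ∨ R.rot.TEdgeV a b) =
      Function.swap (fun a b => R.SEdgeH a b ∨ R.SEdgeV a b) := by
    funext a b
    simp only [rot_TEdgeH, rot_TEdgeV, Function.swap]
  unfold TReach SReach
  rw [this, Relation.reflTransGen_swap]

omit hl in
theorem tr_HSubT (a b : Fin n) : R.tr.HSubT a b ↔ R.VSubT a b := by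
  simp only [HSubT, VSubT, tr_TEdgeH, tr_TReach]
omit hl in
theorem rot_HSubT (a b : Fin n) : R.rot.HSubT a b ↔ R.HSubS a b := by
  simp only [HSubT, HSubS, rot_TEdgeH, rot_TReach]
omit hl in
theorem rot_VSubT (a b : Fin n) : R.rot.VSubT a b ↔ R.VSubS a b := by
  simp only [VSubT, VSubS, rot_TEdgeV, rot_TReach]

omit hl in
theorem CH_VSubT (b c : Fin n) (h : R.CH b c) : R.VSubT c b := by
  rw [← tr_HSubT]
  exact R.tr.CV_HSubT b c ((R.tr_CV _ _).2 h)

omit hl in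
include hgen in
theorem TEdgeH_CV (r q : Fin n) (h : R.TEdgeH r q) :
    ∃ b, R.CV b q ∧ Relation.ReflTransGen R.TEdgeV b r := by
  obtain ⟨b, h1, h2⟩ := R.exists_TVLeaf r
  refine ⟨b, ⟨h1, R.SVLeaf_of_TEdgeH hgen r q h, ?_⟩, h2⟩
  obtain ⟨c1, c2, c3, c4⟩ := R.chain_clear h2
  have hd := R.DR_of_TEdgeH h
  obtain ⟨d1, d2⟩ := hd
  refine ⟨by linarith, fun m m1 m2 => ?_⟩
  have := d2 m m1 m2
  have := c4 m (by linarith) (by linarith)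
  have := R.lt_y r
  have := R.lt_y q
  have := R.lt_y b
  have := R.lt_y m
  grind

include hgen in
theorem TEdgeH_lab (r q : Fin n) (h : R.TEdgeH r q) :
    ℓ r < ℓ q ∧ ∀ b, ℓ q = ℓ b + 1 → R.TReach b r := by
  refine ⟨hl.right _ _ (R.DR_of_TEdgeH h), fun b hb => ?_⟩
  obtain ⟨b', h1, h2⟩ := R.TEdgeH_CV hgen r q h
  have := R.segGapV ℓ hl b' q h1
  have : b = b' := hl.inj (by linarith)
  subst this
  exact R.chain_TReach h2

include hgen in
theorem TEdgeV_lab (r q : Fin n) (h : R.TEdgeV r q) :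
    ℓ q < ℓ r ∧ ∀ b, ℓ b = ℓ q + 1 → R.TReach b r := by
  have := R.tr.TEdgeH_lab (R.tr_generic hgen) _ hl.tr r q ((R.tr_TEdgeH _ _).2 h)
  refine ⟨by linarith [this.1], fun b hb => ?_⟩
  rw [← tr_TReach]
  exact this.2 b (by linarith)

end lab

section char
variable (hgen : R.Generic) (ℓ : Fin n → ℤ) (hl : Lab R ℓ) (τ : Fin n → ℤ)
  (hτ : ∀ a b, R.AdjStep a b → τ a < τ b)
include hτ

theorem tau_edge {a b : Fin n} (h : R.TEdgeH a b ∨ R.TEdgeV a b) : τ a < τ b :=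
  hτ _ _ (h.elim R.Adj_of_TEdgeH R.Adj_of_TEdgeV)

theorem tau_reach {a b : Fin n} (h : R.TReach a b) : τ a ≤ τ b := by
  induction h with
  | refl => exact le_refl _
  | tail _ e ih => exact ih.trans (R.tau_edge τ hτ e).le

omit hτ in
theorem reach_cases {a b : Fin n} (h : R.TReach a b) : a = b ∨ R.HSubT b a ∨ R.VSubT b a := by
  rcases Relation.ReflTransGen.cases_tail h with h | ⟨c, h1, h2 | h2⟩
  · exact Or.inl h.symm
  · exact Or.inr (Or.inl ⟨c, h2, h1⟩)
  · exact Or.inr (Or.inr ⟨c, h2, h1⟩)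

omit hτ in
theorem HSubT_reach {a b : Fin n} (h : R.HSubT b a) : R.TReach a b := by
  obtain ⟨c, h1, h2⟩ := h
  exact Relation.ReflTransGen.tail h2 (Or.inl h1)

omit hτ in
theorem VSubT_reach {a b : Fin n} (h : R.VSubT b a) : R.TReach a b := by
  obtain ⟨c, h1, h2⟩ := h
  exact Relation.ReflTransGen.tail h2 (Or.inr h1)

/-- subtree convexity -/
def Conn (r : Fin n) : Prop := ∀ x y m, R.TReach x r → R.TReach y r → ℓ x ≤ ℓ m → ℓ m ≤ ℓ y →
  R.TReach m r

include hgen hl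

theorem sideH {r h x : Fin n} (hc : R.Conn ℓ h) (e : R.TEdgeH h r) (hx : R.TReach x h) :
    ℓ x < ℓ r ∧ ∀ m, ℓ x ≤ ℓ m → ℓ m < ℓ r → R.TReach m h := by
  obtain ⟨e1, e2⟩ := R.TEdgeH_lab hgen ℓ hl h r e
  have h1 := R.tau_edge τ hτ (Or.inl e)
  obtain ⟨b, hb⟩ := hl.conv h r (ℓ r - 1) (by linarith) (by linarith)
  have hb' := e2 b (by linarith)
  have hlt : ℓ x < ℓ r := by
    by_contra hcon
    push Not at hcon
    have := R.tau_reach τ hτ (hc h x r Relation.ReflTransGen.refl hx e1.le hcon)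
    linarith
  exact ⟨hlt, fun m m1 m2 => hc x b m hx hb' m1 (by linarith)⟩

theorem sideV {r h x : Fin n} (hc : R.Conn ℓ h) (e : R.TEdgeV h r) (hx : R.TReach x h) :
    ℓ r < ℓ x ∧ ∀ m, ℓ r < ℓ m → ℓ m ≤ ℓ x → R.TReach m h := by
  obtain ⟨e1, e2⟩ := R.TEdgeV_lab hgen ℓ hl h r e
  have h1 := R.tau_edge τ hτ (Or.inr e)
  obtain ⟨b, hb⟩ := hl.conv r h (ℓ r + 1) (by linarith) (by linarith)
  have hb' := e2 b (by linarith)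
  have hlt : ℓ r < ℓ x := by
    by_contra hcon
    push Not at hcon
    have := R.tau_reach τ hτ (hc x h r hx Relation.ReflTransGen.refl hcon e1.le)
    linarith
  exact ⟨hlt, fun m m1 m2 => hc b x m hb' hx (by linarith) m2⟩

theorem conn (r : Fin n) : R.Conn ℓ r := by
  have wf : WellFounded (fun a b : Fin n => τ a < τ b) := by
    have : IsTrans (Fin n) (fun a b : Fin n => τ a < τ b) := ⟨fun a b c h1 h2 => h1.trans h2⟩
    have : Std.Irrefl (fun a b : Fin n => τ a < τ b) := ⟨fun a => lt_irrefl _⟩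
    exact Finite.wellFounded_of_trans_of_irrefl _
  induction r using wf.induction with
  | _ r ih =>
    have low : ∀ x, R.TReach x r → ∀ m, ℓ x ≤ ℓ m → ℓ m < ℓ r → R.TReach m r := by
      intro x hx m m1 m2
      rcases R.reach_cases hx with h | ⟨c, h1, h2⟩ | ⟨c, h1, h2⟩
      · subst h; linarith
      · have := R.sideH hgen ℓ hl τ hτ (ih c (R.tau_edge τ hτ (Or.inl h1))) h1 h2
        exact Relation.ReflTransGen.tail (this.2 m m1 m2) (Or.inl h1)
      · have := R.sideV hgen ℓ hl τ hτ (ih c (R.tau_edge τ hτ (Or.inr h1))) h1 h2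
        linarith [this.1]
    have high : ∀ x, R.TReach x r → ∀ m, ℓ m ≤ ℓ x → ℓ r < ℓ m → R.TReach m r := by
      intro x hx m m1 m2
      rcases R.reach_cases hx with h | ⟨c, h1, h2⟩ | ⟨c, h1, h2⟩
      · subst h; linarith
      · have := R.sideH hgen ℓ hl τ hτ (ih c (R.tau_edge τ hτ (Or.inl h1))) h1 h2
        linarith [this.1]
      · have := R.sideV hgen ℓ hl τ hτ (ih c (R.tau_edge τ hτ (Or.inr h1))) h1 h2
        exact Relation.ReflTransGen.tail (this.2 m m2 m1) (Or.inr h1)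
    intro x y m hx hy m1 m2
    rcases lt_trichotomy (ℓ m) (ℓ r) with h | h | h
    · exact low x hx m m1 h
    · rw [hl.inj h]; exact Relation.ReflTransGen.refl
    · exact high y hy m m2 h

omit hτ hl in
theorem reach_total {a b c : Fin n} (h1 : R.TReach a b) (h2 : R.TReach a c) :
    R.TReach b c ∨ R.TReach c b :=
  Relation.ReflTransGen.total_of_right_unique (fun a q q' => R.parent_unique hgen a q q') h1 h2

theorem sub_charH (i k : Fin n) :
    (ℓ k ≤ ℓ i ∧ ∀ m, ℓ k ≤ ℓ m → ℓ m ≤ ℓ i → τ m ≤ τ i) ↔ k = i ∨ R.HSubT i k := by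
  constructor
  · have key : ∀ d : ℕ, ∀ k, ℓ i - ℓ k = d → (∀ m, ℓ k ≤ ℓ m → ℓ m ≤ ℓ i → τ m ≤ τ i) →
        R.TReach k i := by
      intro d
      induction d with
      | zero =>
        intro k hk _
        rw [hl.inj (show ℓ k = ℓ i by push_cast at hk; linarith)]
        exact Relation.ReflTransGen.refl
      | succ d ih =>
        intro k hk hm
        push_cast at hk
        obtain ⟨k', hk'⟩ := hl.conv k i (ℓ k + 1) (by linarith) (by linarith)
        have hr := ih k' (by linarith) (fun m m1 m2 => hm m (by linarith) m2)
        rcases R.gap ℓ hl k k' hk' with h | h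
        · exact Relation.ReflTransGen.trans (R.HSubT_reach (R.CV_HSubT _ _ h)) hr
        · have h' := R.VSubT_reach (R.CH_VSubT _ _ h)
          rcases R.reach_total hgen h' hr with h2 | h2
          · exact h2
          · rcases Relation.ReflTransGen.cases_head h2 with h3 | ⟨c, h3, h4⟩
            · subst h3; exact Relation.ReflTransGen.refl
            · have q1 := R.tau_edge τ hτ h3
              have q2 := R.tau_reach τ hτ h4
              have q3 := hm k le_rfl (by linarith)
              linarith
    rintro ⟨h1, h2⟩
    have hr := key (ℓ i - ℓ k).toNat k (by rw [Int.toNat_of_nonneg]; linarith) h2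
    rcases R.reach_cases hr with h | h | ⟨c, e1, e2⟩
    · exact Or.inl h
    · exact Or.inr h
    · have := R.sideV hgen ℓ hl τ hτ (R.conn hgen ℓ hl τ hτ c) e1 e2
      linarith [this.1]
  · rintro (h | ⟨c, e1, e2⟩)
    · subst h
      refine ⟨le_refl _, fun m m1 m2 => ?_⟩
      rw [hl.inj (le_antisymm m2 m1)]
    · have := R.sideH hgen ℓ hl τ hτ (R.conn hgen ℓ hl τ hτ c) e1 e2
      refine ⟨this.1.le, fun m m1 m2 => ?_⟩
      rcases m2.lt_or_eq with h | h
      · exact (R.tau_reach τ hτ (this.2 m m1 h)).trans (R.tau_edge τ hτ (Or.inl e1)).le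
      · rw [hl.inj h]

theorem sub_charV (i k : Fin n) :
    (ℓ i ≤ ℓ k ∧ ∀ m, ℓ i ≤ ℓ m → ℓ m ≤ ℓ k → τ m ≤ τ i) ↔ k = i ∨ R.VSubT i k := by
  have := R.tr.sub_charH (R.tr_generic hgen) _ hl.tr τ (fun a b h => hτ a b ((R.tr_Adj _ _).1 h)) i k
  rw [tr_HSubT] at this
  rw [← this]
  simp only [neg_le_neg_iff]
  exact and_congr_right fun _ => forall_congr' fun m => ⟨fun h a b => h b a, fun h a b => h b a⟩

omit hgen hl in
theorem HSubT_ne (i k : Fin n) (h : R.HSubT i k) : k ≠ i := by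
  rintro rfl
  obtain ⟨c, e1, e2⟩ := h
  have h1 := R.tau_edge τ hτ (Or.inl e1)
  have h2 := R.tau_reach τ hτ e2
  linarith

end char

theorem chain_or {b a c i : Fin n} (hgen : R.Generic) (h : Relation.ReflTransGen R.TEdgeV b a)
    (hc : R.TEdgeH a c) (hi : R.TReach b i) :
    Relation.ReflTransGen R.TEdgeV b i ∨ R.TReach c i := by
  induction h using Relation.ReflTransGen.head_induction_on with
  | refl =>
    rcases Relation.ReflTransGen.cases_head hi with h | ⟨d, h1, h2⟩
    · subst h; exact Or.inl Relation.ReflTransGen.refl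
    · rw [R.parent_unique hgen a c d (Or.inl hc) h1]; exact Or.inr h2
  | @head x y e _ ih =>
    rcases Relation.ReflTransGen.cases_head hi with h | ⟨d, h1, h2⟩
    · subst h; exact Or.inl Relation.ReflTransGen.refl
    · rw [← R.parent_unique hgen x y d (Or.inr e) h1] at h2
      rcases ih h2 with h | h
      · exact Or.inl (h.head e)
      · exact Or.inr h

theorem rot_chain {a b : Fin n} (h : Relation.ReflTransGen R.rot.TEdgeV a b) :
    Relation.ReflTransGen R.SEdgeV b a := by
  have : R.rot.TEdgeV = Function.swap R.SEdgeV := by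
    funext a b
    exact propext (R.rot_TEdgeV a b)
  rw [this, Relation.reflTransGen_swap] at h
  exact h

theorem precS_of_TReach {a b : Fin n} (h : R.TReach a b) : a = b ∨ R.PrecS a b := by
  induction h with
  | refl => exact Or.inl rfl
  | @tail b c _ e ih =>
    have e' : R.AdjStep b c := e.elim R.Adj_of_TEdgeH R.Adj_of_TEdgeV
    right
    rcases ih with h | h
    · subst h; exact Relation.TransGen.single (Or.inl e')
    · exact Relation.TransGen.tail h (Or.inl e')

theorem precS_of_SReach {a b : Fin n} (h : R.SReach a b) : a = b ∨ R.PrecS a b := by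
  induction h with
  | refl => exact Or.inl rfl
  | @tail b c _ e ih =>
    have e' : R.AdjStep b c := by
      rw [← rot_Adj]
      rw [← rot_TEdgeH, ← rot_TEdgeV] at e
      exact e.elim R.rot.Adj_of_TEdgeH R.rot.Adj_of_TEdgeV
    right
    rcases ih with h | h
    · subst h; exact Relation.TransGen.single (Or.inl e')
    · exact Relation.TransGen.tail h (Or.inl e')

theorem precS_comp {j b i : Fin n} (hne : j ≠ i) (h1 : j = b ∨ R.PrecS j b)
    (h2 : b = i ∨ R.PrecS b i) : R.PrecS j i := by
  rcases h1 with rfl | h1 <;> rcases h2 with rfl | h2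
  · exact absurd rfl hne
  · exact h2
  · exact h1
  · exact Relation.TransGen.trans h1 h2

/-- two rectangles on both sides of a vertical segment are comparable in the strong poset -/
theorem seg_compare (hgen : R.Generic) (i j : Fin n) (hd : R.DR j i) :
    R.PrecS i j ∨ R.PrecS j i := by
  obtain ⟨hx, hc⟩ := hd
  have b1 := R.lt_y i
  have b2 := R.lt_y j
  rcases lt_trichotomy (R.yt j) (R.yb i) with h | h | h
  · right
    have hdr := (R.dirRightOf_iff j i).2 ⟨hx, hc⟩
    refine Relation.TransGen.single (Or.inr (Or.inl ⟨hx.symm, ?_, h⟩))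
    have := hdr.2
    simpa only [SameVSeg, min_comm, max_comm] using this
  · obtain ⟨m, h1, h2⟩ := R.TEdgeV_of_corner i j hx.symm h.symm
    exact (R.no_four hgen m j i h2 h1).elim
  · left
    by_cases hov : R.yb j < R.yt i
    · refine Relation.TransGen.single (Or.inl (Or.inl ⟨hx.symm, ?_⟩))
      simp only [max_lt_iff, lt_min_iff]
      exact ⟨⟨b1, hov⟩, ⟨h, b2⟩⟩
    · push Not at hov
      have b3 := R.lt_x i
      have b4 := R.lt_x j
      have b5 := R.xl_nonneg i
      have b6 := R.xr_le_one j
      have b7 := R.yb_nonneg i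
      have b8 := R.yt_le_one j
      obtain ⟨l, l1, l2, l3, l4⟩ := R.quadNW (R.xl j) (R.yb j) (by linarith) (by linarith)
        (by linarith) (by linarith)
      have hlx : R.xr l = R.xl j := by
        by_contra hne
        have := R.eq_of_overlap l j (by linarith) (lt_of_le_of_ne l2 (Ne.symm hne)) (by linarith) l4
        subst this
        exact lt_irrefl _ l1
      have hadj : R.AdjStep l j := by
        refine Or.inl ⟨hlx, ?_⟩
        simp only [max_lt_iff, lt_min_iff]
        exact ⟨⟨by linarith, by linarith⟩, ⟨by linarith, b2⟩⟩
      have hch : i = l ∨ R.PrecS i l := by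
        rcases R.stack_or i l (by linarith) with h' | h' | h'
        · exact Or.inl h'
        · refine R.precS_of_TReach (R.chain_TReach (R.stack l i (by linarith) h' ?_))
          intro m m1 m2
          have := hc m (by linarith) (by linarith)
          have := R.cross_right m l (by linarith) (by linarith)
          have := R.lt_y m
          grind
        · linarith
      rcases hch with h' | h'
      · subst h'; exact Relation.TransGen.single (Or.inl hadj)
      · exact Relation.TransGen.tail h' (Or.inl hadj)

theorem lab_of_inorder (hlab : R.InorderLabeled) : Lab R (fun i => ((i : ℕ) : ℤ)) where
  right i j h := by
    have : i < j := (hlab i j).1 (Relation.TransGen.single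
      (Or.inl (Relation.TransGen.single ((R.dirRightOf_iff _ _).2 h))))
    simpa using this
  above i j h := by
    have : i < j := (hlab i j).1 (Relation.TransGen.single
      (Or.inr (Relation.TransGen.single ((R.dirAbove_iff _ _).2 h))))
    simpa using this
  step i j h := by
    have hij : i < j := by rw [Fin.lt_def]; omega
    have hE : ∀ a b, (R.DR b a ∨ R.DA a b) → a < b := by
      intro a b h
      refine (hlab a b).1 (Relation.TransGen.single ?_)
      rcases h with h | h
      · exact Or.inl (Relation.TransGen.single ((R.dirRightOf_iff _ _).2 h))
      · exact Or.inr (Relation.TransGen.single ((R.dirAbove_iff _ _).2 h))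
    have h1 : ∀ a b, R.RightOf b a → Relation.TransGen (fun a b => R.DR b a ∨ R.DA a b) a b := by
      intro a b h
      induction h with
      | single h => exact Relation.TransGen.single (Or.inl ((R.dirRightOf_iff _ _).1 h))
      | tail _ h ih => exact Relation.TransGen.head (Or.inl ((R.dirRightOf_iff _ _).1 h)) ih
    have h2 : ∀ a b, R.Above a b → Relation.TransGen (fun a b => R.DR b a ∨ R.DA a b) a b := by
      intro a b h
      induction h with
      | single h => exact Relation.TransGen.single (Or.inr ((R.dirAbove_iff _ _).1 h))
      | tail _ h ih => exact Relation.TransGen.tail ih (Or.inr ((R.dirAbove_iff _ _).1 h))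
    have h3 : Relation.TransGen (fun a b => R.DR b a ∨ R.DA a b) i j := by
      have aux : ∀ c, R.InorderLT i c →
          Relation.TransGen (fun a b => R.DR b a ∨ R.DA a b) i c := by
        intro c hc
        induction hc with
        | single h => exact h.elim (h1 _ _) (h2 _ _)
        | tail _ h ih => exact Relation.TransGen.trans ih (h.elim (h1 _ _) (h2 _ _))
      exact aux j ((hlab i j).2 hij)
    obtain ⟨c, hc, hcj⟩ := Relation.TransGen.head'_iff.1 h3
    have q1 := hE _ _ hc
    have q2 : c ≤ j := by
      clear hc q1
      induction hcj using Relation.ReflTransGen.head_induction_on with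
      | refl => exact le_refl _
      | head e _ ih => exact (hE _ _ e).le.trans ih
    have : c = j := by
      rw [Fin.lt_def] at q1
      rw [Fin.le_def] at q2
      exact Fin.ext (by omega)
    subst this
    exact hc
  inj i j h := by
    simp only [Nat.cast_inj] at h
    exact Fin.ext h
  conv i j k h1 h2 := by
    refine ⟨⟨k.toNat, ?_⟩, ?_⟩
    · have := j.2
      omega
    · simp only
      omega

end Rectangulation

open Rectangulation

/-- Pairs of consecutive intervals are triples of bounds. -/
theorem pairs_card {n : ℕ} (s : Fin n → Fin n) (i j : Fin n) (hs : s j < s i) :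
    {p : Finset (Fin n) × Finset (Fin n) |
        ConsecIntervals p.1 p.2 ∧ i ∈ p.1 ∧ j ∈ p.2 ∧
          (∀ k ∈ p.1, s k ≤ s i) ∧ (∀ k ∈ p.2, s j ≤ s k) ∧ s j < s i}.ncard =
    {a | a ≤ i ∧ ∀ m, a ≤ m → m ≤ i → s m ≤ s i}.ncard *
      ({b | i ≤ b ∧ b < j ∧ (∀ m, i ≤ m → m ≤ b → s m ≤ s i) ∧
          ∀ m, b < m → m ≤ j → s j ≤ s m}.ncard *
        {c | j ≤ c ∧ ∀ m, j ≤ m → m ≤ c → s j ≤ s m}.ncard) := by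
  rw [← Set.ncard_prod, ← Set.ncard_prod]
  rw [← Set.ncard_image_of_injOn
    (f := fun t : Fin n × (Fin n × Fin n) => (Finset.Icc t.1 t.2.1, Finset.Ioc t.2.1 t.2.2))]
  · congr 1
    ext ⟨I, J⟩
    simp only [Set.mem_setOf_eq, Set.mem_image, Set.mem_prod, Prod.exists, Prod.mk.injEq]
    constructor
    · rintro ⟨⟨hI, hJ, hIJ⟩, hi, hj, h1, h2, -⟩
      have eI : Finset.Icc (I.min' hI.1) (I.max' hI.1) = I := by
        ext k
        rw [Finset.mem_Icc]
        exact ⟨fun ⟨a, b⟩ => hI.2 _ _ _ (I.min'_mem hI.1) (I.max'_mem hI.1) a b,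
          fun h => ⟨I.min'_le k h, I.le_max' k h⟩⟩
      have eJ : Finset.Ioc (I.max' hI.1) (J.max' hJ.1) = J := by
        ext k
        rw [Finset.mem_Ioc]
        refine ⟨fun ⟨a, b⟩ => hJ.2 _ _ _ (J.min'_mem hJ.1) (J.max'_mem hJ.1) ?_ b,
          fun h => ⟨?_, J.le_max' k h⟩⟩
        · rw [Fin.lt_def] at a
          rw [Fin.le_def]
          omega
        · have := J.min'_le k h
          rw [Fin.le_def] at this
          rw [Fin.lt_def]
          omega
      have hi' := hi
      have hj' := hj
      rw [← eI, Finset.mem_Icc] at hi'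
      rw [← eJ, Finset.mem_Ioc] at hj'
      rw [← eI] at h1
      rw [← eJ] at h2
      refine ⟨I.min' hI.1, I.max' hI.1, J.max' hJ.1, ⟨⟨hi'.1, fun m a b => ?_⟩,
        ⟨hi'.2, hj'.1, fun m a b => ?_, fun m a b => ?_⟩, hj'.2, fun m a b => ?_⟩, eI, eJ⟩
      · exact h1 m (Finset.mem_Icc.2 ⟨a, b.trans hi'.2⟩)
      · exact h1 m (Finset.mem_Icc.2 ⟨hi'.1.trans a, b⟩)
      · exact h2 m (Finset.mem_Ioc.2 ⟨a, b.trans hj'.2⟩)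
      · exact h2 m (Finset.mem_Ioc.2 ⟨hj'.1.trans_le a, b⟩)
    · rintro ⟨a, b, c, ⟨⟨ha, ha'⟩, ⟨hb1, hb2, hb3, hb4⟩, hc, hc'⟩, rfl, rfl⟩
      have iI : IsInterval (Finset.Icc a b) := ⟨⟨i, Finset.mem_Icc.2 ⟨ha, hb1⟩⟩, by
        intro x y z hx hz h1 h2
        rw [Finset.mem_Icc] at *
        exact ⟨hx.1.trans h1, h2.trans hz.2⟩⟩
      have iJ : IsInterval (Finset.Ioc b c) := ⟨⟨j, Finset.mem_Ioc.2 ⟨hb2, hc⟩⟩, by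
        intro x y z hx hz h1 h2
        rw [Finset.mem_Ioc] at *
        exact ⟨hx.1.trans_le h1, h2.trans hz.2⟩⟩
      refine ⟨⟨iI, iJ, ?_⟩, Finset.mem_Icc.2 ⟨ha, hb1⟩, Finset.mem_Ioc.2 ⟨hb2, hc⟩, ?_, ?_, hs⟩
      · have e1 : (Finset.Icc a b).max' iI.1 = b :=
          le_antisymm (Finset.mem_Icc.1 ((Finset.Icc a b).max'_mem iI.1)).2
            (Finset.le_max' _ _ (Finset.mem_Icc.2 ⟨ha.trans hb1, le_rfl⟩))
        rw [e1]
        have e2 := (Finset.mem_Ioc.1 ((Finset.Ioc b c).min'_mem iJ.1)).1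
        have hj := j.2
        have hbc : b < c := hb2.trans_le hc
        rw [Fin.lt_def] at hb2 e2 hbc
        have e3 := Finset.min'_le (Finset.Ioc b c) ⟨b + 1, by omega⟩ (Finset.mem_Ioc.2
          ⟨by rw [Fin.lt_def]; simp, by rw [Fin.le_def]; simp only; omega⟩)
        rw [Fin.le_def] at e3
        simp only at e3
        omega
      · intro k hk
        rw [Finset.mem_Icc] at hk
        rcases le_total k i with h | h
        · exact ha' k hk.1 h
        · exact hb3 k h hk.2
      · intro k hk
        rw [Finset.mem_Ioc] at hk
        rcases le_total k j with h | h
        · exact hb4 k hk.1 h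
        · exact hc' k h hk.2
  · rintro ⟨a, b, c⟩ ⟨⟨ha, -⟩, ⟨hb1, hb2, -, -⟩, hc, -⟩ ⟨a', b', c'⟩ ⟨⟨ha', -⟩, ⟨hb1', hb2', -, -⟩, hc', -⟩ h
    simp only [Prod.mk.injEq] at h ha hb1 hb2 hc ha' hb1' hb2' hc'
    obtain ⟨h1, h2⟩ := h
    have q1 : a ∈ Finset.Icc a' b' := h1 ▸ Finset.mem_Icc.2 ⟨le_rfl, ha.trans hb1⟩
    have q2 : a' ∈ Finset.Icc a b := h1 ▸ Finset.mem_Icc.2 ⟨le_rfl, ha'.trans hb1'⟩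
    have q3 : b ∈ Finset.Icc a' b' := h1 ▸ Finset.mem_Icc.2 ⟨ha.trans hb1, le_rfl⟩
    have q4 : b' ∈ Finset.Icc a b := h1 ▸ Finset.mem_Icc.2 ⟨ha'.trans hb1', le_rfl⟩
    have q5 : c ∈ Finset.Ioc b' c' := h2 ▸ Finset.mem_Ioc.2 ⟨hb2.trans_le hc, le_rfl⟩
    have q6 : c' ∈ Finset.Ioc b c := h2 ▸ Finset.mem_Ioc.2 ⟨hb2'.trans_le hc', le_rfl⟩
    rw [Finset.mem_Icc] at q1 q2 q3 q4
    rw [Finset.mem_Ioc] at q5 q6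
    simp only [Prod.mk.injEq]
    exact ⟨le_antisymm q2.1 q1.1, le_antisymm q3.2 q4.2, le_antisymm q5.2 q6.2⟩

theorem ncard_insert_sub {n : ℕ} (P : Fin n → Prop) (i : Fin n) (h : ∀ k, P k → k ≠ i) :
    {k | k = i ∨ P k}.ncard = 1 + {k | P k}.ncard := by
  have : {k | k = i ∨ P k} = insert i {k | P k} := rfl
  have hi : i ∉ {k | P k} := fun hi => h i hi rfl
  rw [this, Set.ncard_insert_of_notMem hi, add_comm]

namespace Rectangulation
variable {n : ℕ} (R : Rectangulation n)

section final
variable (hgen : R.Generic) (hl : Lab R (fun i => ((i : ℕ) : ℤ))) (s : Fin n → Fin n)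
  (hs : ∀ a b, R.PrecS a b → s a < s b)

/-- The possible cut positions. -/
def Cut (s : Fin n → Fin n) (i j b : Fin n) : Prop :=
  i ≤ b ∧ b < j ∧ (∀ m, i ≤ m → m ≤ b → s m ≤ s i) ∧ ∀ m, b < m → m ≤ j → s j ≤ s m

include hs

theorem tau_adj (a b : Fin n) (h : R.AdjStep a b) : ((s a : ℕ) : ℤ) < ((s b : ℕ) : ℤ) := by
  have := hs a b (Relation.TransGen.single (Or.inl h))
  rw [Fin.lt_def] at this
  exact_mod_cast this

theorem tau_adj' (a b : Fin n) (h : R.rot.AdjStep a b) :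
    -((s a : ℕ) : ℤ) < -((s b : ℕ) : ℤ) := by
  have := R.tau_adj s hs b a ((R.rot_Adj _ _).1 h)
  linarith

include hgen hl

theorem char_HT (i k : Fin n) :
    (k ≤ i ∧ ∀ m, k ≤ m → m ≤ i → s m ≤ s i) ↔ k = i ∨ R.HSubT i k := by
  have := R.sub_charH hgen _ hl _ (R.tau_adj s hs) i k
  simpa only [Nat.cast_le, Fin.val_fin_le] using this

theorem char_VT (i k : Fin n) :
    (i ≤ k ∧ ∀ m, i ≤ m → m ≤ k → s m ≤ s i) ↔ k = i ∨ R.VSubT i k := by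
  have := R.sub_charV hgen _ hl _ (R.tau_adj s hs) i k
  simpa only [Nat.cast_le, Fin.val_fin_le] using this

theorem char_HS (i k : Fin n) :
    (i ≤ k ∧ ∀ m, i ≤ m → m ≤ k → s i ≤ s m) ↔ k = i ∨ R.HSubS i k := by
  have := R.rot.sub_charH (R.rot_generic hgen) _ hl.rot _ (R.tau_adj' s hs) i k
  simp only [neg_le_neg_iff, Nat.cast_le, Fin.val_fin_le, rot_HSubT] at this
  rw [← this]
  exact and_congr_right fun _ => forall_congr' fun m => ⟨fun h a b => h b a, fun h a b => h b a⟩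

theorem char_VS (i k : Fin n) :
    (k ≤ i ∧ ∀ m, k ≤ m → m ≤ i → s i ≤ s m) ↔ k = i ∨ R.VSubS i k := by
  have := R.rot.sub_charV (R.rot_generic hgen) _ hl.rot _ (R.tau_adj' s hs) i k
  simp only [neg_le_neg_iff, Nat.cast_le, Fin.val_fin_le, rot_VSubT] at this
  rw [← this]
  exact and_congr_right fun _ => forall_congr' fun m => ⟨fun h a b => h b a, fun h a b => h b a⟩

theorem card_HT (i : Fin n) : {k | k ≤ i ∧ ∀ m, k ≤ m → m ≤ i → s m ≤ s i}.ncard = R.hT i := by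
  simp only [R.char_HT hgen hl s hs]
  exact ncard_insert_sub _ _ (fun k => R.HSubT_ne _ (R.tau_adj s hs) i k)

theorem card_HS (i : Fin n) : {k | i ≤ k ∧ ∀ m, i ≤ m → m ≤ k → s i ≤ s m}.ncard = R.hS i := by
  simp only [R.char_HS hgen hl s hs]
  refine ncard_insert_sub _ _ (fun k hk => ?_)
  rw [← rot_HSubT] at hk
  exact R.rot.HSubT_ne _ (R.tau_adj' s hs) i k hk

theorem cut_iff (i j b c : Fin n) (hc : (c : ℕ) = b + 1) :
    Cut s i j b ↔ (b = i ∨ R.VSubT i b) ∧ (c = j ∨ R.VSubS j c) := by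
  rw [← R.char_VT hgen hl s hs, ← R.char_VS hgen hl s hs, Cut]
  have e : ∀ m : Fin n, c ≤ m ↔ b < m := by
    intro m
    rw [Fin.le_def, Fin.lt_def]
    omega
  simp only [e]
  tauto

omit hs hgen hl in
theorem CH_VSubS (b c : Fin n) (h : R.CH c b) : R.VSubS c b := by
  rw [← rot_VSubT]
  exact R.rot.CH_VSubT b c ((R.rot_CH _ _).2 h)

omit hs hgen hl in
theorem VSubS_reach {a b : Fin n} (h : R.VSubS b a) : R.SReach b a := by
  obtain ⟨c, h1, h2⟩ := h
  exact Relation.ReflTransGen.head (Or.inr h1) h2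

omit hs hgen hl in
theorem VSubT_trans {a b c : Fin n} (h : b = a ∨ R.VSubT a b) (h' : R.VSubT b c) :
    R.VSubT a c := by
  rcases h with rfl | ⟨r, h1, h2⟩
  · exact h'
  · exact ⟨r, h1, Relation.ReflTransGen.trans (R.VSubT_reach h') h2⟩

omit hs hgen hl in
theorem VSubS_trans {a b c : Fin n} (h : b = a ∨ R.VSubS a b) (h' : R.VSubS b c) :
    R.VSubS a c := by
  rcases h with rfl | ⟨r, h1, h2⟩
  · exact h'
  · exact ⟨r, h1, Relation.ReflTransGen.trans h2 (R.VSubS_reach h')⟩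

/-- a horizontal gap is contained in the vertical subtrees -/
theorem cut_CH (i j b c : Fin n) (hc : (c : ℕ) = b + 1) (h : R.CH c b) :
    Cut s i j b ↔ R.VSubT i c ∧ R.VSubS j b := by
  rw [R.cut_iff hgen hl s hs i j b c hc]
  constructor
  · rintro ⟨h1, h2⟩
    exact ⟨R.VSubT_trans h1 (R.CH_VSubT _ _ h), R.VSubS_trans h2 (R.CH_VSubS _ _ h)⟩
  · rintro ⟨h1, h2⟩
    have q1 := (R.char_VT hgen hl s hs i c).2 (Or.inr h1)
    have q2 := (R.char_VS hgen hl s hs j b).2 (Or.inr h2)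
    have n1 : c ≠ i := by
      rintro rfl
      rw [← tr_HSubT] at h1
      exact R.tr.HSubT_ne _ (fun a b h => R.tau_adj s hs a b ((R.tr_Adj _ _).1 h)) c c h1 rfl
    have n2 : b ≠ j := by
      rintro rfl
      rw [← rot_VSubT, ← tr_HSubT] at h2
      exact R.rot.tr.HSubT_ne _ (fun a b h => R.tau_adj' s hs a b ((R.rot.tr_Adj _ _).1 h)) b b h2 rfl
    have n1' : (c : ℕ) ≠ i := fun h => n1 (Fin.ext h)
    have n2' : (b : ℕ) ≠ j := fun h => n2 (Fin.ext h)
    have q1' := q1.1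
    have q2' := q2.1
    rw [Fin.le_def] at q1' q2'
    have bc : b ≤ c := by rw [Fin.le_def]; omega
    constructor
    · rw [← R.char_VT hgen hl s hs]
      exact ⟨by rw [Fin.le_def]; omega, fun m m1 m2 => q1.2 m m1 (m2.trans bc)⟩
    · rw [← R.char_VS hgen hl s hs]
      exact ⟨by rw [Fin.le_def]; omega, fun m m1 m2 => q2.2 m (bc.trans m1) m2⟩

omit hs in
theorem CV_CH_false (b c : Fin n) (h : R.CV b c) (h' : R.CH c b) : False := by
  obtain ⟨h1, h2, h3⟩ := h
  have := h3.1
  have := R.lt_x c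
  have := R.xr_le_one c
  obtain ⟨d, hd⟩ := R.bottomRight b h1 (by linarith)
  exact h'.2.1 ⟨d, hd⟩

theorem card_cut (i j : Fin n) : {b | Cut s i j b}.ncard = R.cv i j := by
  have hV : ∀ a c, R.CV a c → (c : ℕ) = a + 1 := by
    intro a c h
    have := R.segGapV _ hl a c h
    omega
  have hH : ∀ a c, R.CH c a → (c : ℕ) = a + 1 := by
    intro a c h
    have := R.segGapH _ hl c a h
    omega
  rw [cv]
  simp only [commonV_iff, commonH_iff]
  rw [← Set.ncard_image_of_injOn (f := fun p : Fin n × Fin n => min p.1 p.2)]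
  · congr 1
    ext b
    simp only [Set.mem_setOf_eq, Set.mem_image, Prod.exists]
    constructor
    · intro hb
      have hlt := hb.2.1
      have hjn := j.2
      rw [Fin.lt_def] at hlt
      obtain ⟨c, hc⟩ : ∃ c : Fin n, (c : ℕ) = b + 1 := ⟨⟨b + 1, by omega⟩, rfl⟩
      have bc : b ≤ c := by rw [Fin.le_def]; omega
      rcases R.gap _ hl b c (by omega) with h | h
      · refine ⟨b, c, Or.inl ⟨h, ?_⟩, min_eq_left bc⟩
        have := (R.cut_iff hgen hl s hs i j b c hc).1 hb
        exact ⟨this.1.symm, this.2.symm⟩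
      · exact ⟨c, b, Or.inr ⟨h, (R.cut_CH hgen hl s hs i j b c hc h).1 hb⟩, min_eq_right bc⟩
    · rintro ⟨p, q, (⟨h, h1, h2⟩ | ⟨h, h1, h2⟩), rfl⟩
      · have hc := hV _ _ h
        rw [min_eq_left (by rw [Fin.le_def]; omega)]
        exact (R.cut_iff hgen hl s hs i j p q hc).2 ⟨h1.symm, h2.symm⟩
      · have hc := hH _ _ h
        rw [min_eq_right (by rw [Fin.le_def]; omega)]
        exact (R.cut_CH hgen hl s hs i j q p hc h).2 ⟨h1, h2⟩
  · rintro ⟨p, q⟩ hpq ⟨p', q'⟩ hpq' he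
    simp only [Set.mem_setOf_eq] at hpq hpq' he
    rcases hpq with ⟨h, -⟩ | ⟨h, -⟩ <;> rcases hpq' with ⟨h', -⟩ | ⟨h', -⟩
    · have e1 := hV _ _ h
      have e2 := hV _ _ h'
      rw [min_eq_left (by rw [Fin.le_def]; omega), min_eq_left (by rw [Fin.le_def]; omega)] at he
      subst he
      rw [Fin.ext (e1.trans e2.symm)]
    · have e1 := hV _ _ h
      have e2 := hH _ _ h'
      rw [min_eq_left (by rw [Fin.le_def]; omega), min_eq_right (by rw [Fin.le_def]; omega)] at he
      subst he
      have : q = p' := Fin.ext (e1.trans e2.symm)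
      subst this
      exact (R.CV_CH_false hgen hl _ _ h h').elim
    · have e1 := hH _ _ h
      have e2 := hV _ _ h'
      rw [min_eq_right (by rw [Fin.le_def]; omega), min_eq_left (by rw [Fin.le_def]; omega)] at he
      subst he
      have : q' = p := Fin.ext (e2.trans e1.symm)
      subst this
      exact (R.CV_CH_false hgen hl _ _ h' h).elim
    · have e1 := hH _ _ h
      have e2 := hH _ _ h'
      rw [min_eq_right (by rw [Fin.le_def]; omega), min_eq_right (by rw [Fin.le_def]; omega)] at he
      subst he
      rw [Fin.ext (e1.trans e2.symm)]

theorem cut_precS (i j b : Fin n) (hne : j ≠ i) (hsij : s j < s i) (hb : Cut s i j b) :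
    R.PrecS j i := by
  have hlt := hb.2.1
  have hjn := j.2
  rw [Fin.lt_def] at hlt
  obtain ⟨c, hc⟩ : ∃ c : Fin n, (c : ℕ) = b + 1 := ⟨⟨b + 1, by omega⟩, rfl⟩
  obtain ⟨h1, h2⟩ := (R.cut_iff hgen hl s hs i j b c hc).1 hb
  have r1 : R.TReach b i := by
    rcases h1 with h1 | h1
    · subst h1; exact Relation.ReflTransGen.refl
    · exact R.VSubT_reach h1
  have r2 : R.SReach j c := by
    rcases h2 with h2 | h2
    · subst h2; exact Relation.ReflTransGen.refl
    · exact R.VSubS_reach h2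
  rcases R.gap _ hl b c (by omega) with h | h
  · obtain ⟨a, k1, k2⟩ := R.CV_chain b c h
    obtain ⟨a', k1', k2'⟩ := R.rot.CV_chain c b ((R.rot_CV _ _).2 h)
    rcases R.chain_or hgen k1 k2 r1 with g | g
    · rcases R.rot.chain_or (R.rot_generic hgen) k1' k2' ((R.rot_TReach _ _).2 r2) with g' | g'
      · obtain ⟨x1, x2, x3, x4⟩ := R.chain_clear g
        obtain ⟨y1, y2, y3, y4⟩ := R.rot.chain_clear g'
        simp only [Rectangulation.rot] at y1 y2 y3 y4
        obtain ⟨d1, d2⟩ := h.2.2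
        have : R.DR j i := by
          refine ⟨by linarith, fun m m1 m2 => ?_⟩
          have t1 := x4 m (by linarith) (by linarith)
          have t2 := y4 m (by linarith) (by linarith)
          have t3 := d2 m (by linarith) (by linarith)
          have := R.lt_y m
          have := R.lt_y i
          have := R.lt_y j
          have := R.lt_y b
          have := R.lt_y c
          grind
        rcases R.seg_compare hgen i j this with h | h
        · exact absurd (hs _ _ h) (lt_asymm hsij)
        · exact h
      · rw [rot_TReach] at g'
        exact R.precS_comp hne (R.precS_of_SReach g') (R.precS_of_TReach r1)
    · exact R.precS_comp hne (R.precS_of_SReach r2) (R.precS_of_TReach g)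
  · have h3 := (R.cut_CH hgen hl s hs i j b c hc h).1 hb
    exact R.precS_comp hne (R.precS_of_SReach (R.VSubS_reach h3.2)) (R.precS_of_TReach r1)

end final

end Rectangulation

/-- Loday coordinates of strong rectangulotopes: for a
generic inorder-labeled rectangulation `R` with source tree `S`, target tree
`T`, a linear extension `σ` of the strong poset `≺_s^R`, and `i < j` in `[n]`,
the number of pairs `(I,J)` of nonempty consecutive intervals of `[n]` with
`i ∈ I`, `j ∈ J`, `σ⁻¹(i) = max_{k ∈ I} σ⁻¹(k)`, `σ⁻¹(j) = min_{k ∈ J} σ⁻¹(k)`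
and `σ⁻¹(i) > σ⁻¹(j)` equals `h^T_i · cv^{T,S}_{i,j} · h^S_j` if `j ≺_s^R i`,
and `0` otherwise. -/
theorem strong_loday_coordinates (n : ℕ) (R : Rectangulation n)
    (hgen : R.Generic) (hlab : R.InorderLabeled)
    (σ : Equiv.Perm (Fin n)) (hσ : ∀ a b, R.PrecS a b → σ.symm a < σ.symm b)
    (i j : Fin n) (hij : i < j) :
    {p : Finset (Fin n) × Finset (Fin n) |
        ConsecIntervals p.1 p.2 ∧ i ∈ p.1 ∧ j ∈ p.2 ∧
          (∀ k ∈ p.1, σ.symm k ≤ σ.symm i) ∧ (∀ k ∈ p.2, σ.symm j ≤ σ.symm k) ∧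
          σ.symm j < σ.symm i}.ncard =
      (if R.PrecS j i then R.hT i * R.cv i j * R.hS j else 0) := by
  have hl := R.lab_of_inorder hlab
  by_cases hp : R.PrecS j i
  · rw [if_pos hp, pairs_card σ.symm i j (hσ _ _ hp), R.card_HT hgen hl σ.symm hσ,
      R.card_HS hgen hl σ.symm hσ, ← R.card_cut hgen hl σ.symm hσ i j, mul_assoc]
    rfl
  · rw [if_neg hp]
    by_cases hlt : σ.symm j < σ.symm i
    · rw [pairs_card σ.symm i j hlt]
      have : {b | i ≤ b ∧ b < j ∧ (∀ m, i ≤ m → m ≤ b → σ.symm m ≤ σ.symm i) ∧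
          ∀ m, b < m → m ≤ j → σ.symm j ≤ σ.symm m} = ∅ := by
        ext b
        simp only [Set.mem_empty_iff_false, iff_false]
        intro hb
        exact hp (R.cut_precS hgen hl σ.symm hσ i j b hij.ne' hlt hb)
      rw [this]
      simp
    · simp [hlt]


end
end

section
/- Let R be a generic rectangulation of size n with source tree S = S(R), target tree T = T(R) and strong poset ≺_s^R, and let i < j in [n] be such that j ≺_s^R i does NOT hold. If cv^{T,S}_{i,j} > 0, then the vertical pattern i‖j holds, i.e., the rectangles r_i and r_j share a vertical segment containing the right edge of r_i and the left edge of r_j, and the bottom edge of r_i is below the top edge of r_j. -/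
open Classical Pointwise

noncomputable section

namespace Rectangulation

variable {n : ℕ} (R : Rectangulation n)

/-! ### Helper lemmas -/

theorem disj {u v : Fin n} (h : u ≠ v) :
    R.xr u ≤ R.xl v ∨ R.xr v ≤ R.xl u ∨ R.yt u ≤ R.yb v ∨ R.yt v ≤ R.yb u := by
  by_contra hc
  push Not at hc
  obtain ⟨h1, h2, h3, h4⟩ := hc
  obtain ⟨x, hx1, hx2⟩ := exists_between
    (max_lt (lt_min (R.lt_x u) h2) (lt_min h1 (R.lt_x v)) :
      max (R.xl u) (R.xl v) < min (R.xr u) (R.xr v))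
  obtain ⟨y, hy1, hy2⟩ := exists_between
    (max_lt (lt_min (R.lt_y u) h4) (lt_min h3 (R.lt_y v)) :
      max (R.yb u) (R.yb v) < min (R.yt u) (R.yt v))
  rw [max_lt_iff] at hx1 hy1
  rw [lt_min_iff] at hx2 hy2
  exact R.interiors_disjoint u v h ⟨(x, y), ⟨hx1.1, hx2.1, hy1.1, hy2.1⟩,
    ⟨hx1.2, hx2.2, hy1.2, hy2.2⟩⟩

theorem gap_s12 (f : Fin n → ℝ) (p : ℝ) :
    ∃ ε > 0, ∀ δ, 0 < δ → δ < ε → ∀ c, (p < f c → p + δ < f c) ∧ (f c < p → f c < p - δ) := by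
  have h : ∀ c, ∀ᶠ δ in nhds (0 : ℝ), (p < f c → p + δ < f c) ∧ (f c < p → f c < p - δ) := by
    intro c
    rcases lt_trichotomy p (f c) with h | h | h
    · filter_upwards [gt_mem_nhds (show (0 : ℝ) < f c - p by linarith)] with δ hδ
      exact ⟨fun _ => by linarith, fun _ => by linarith⟩
    · exact Filter.Eventually.of_forall fun δ => ⟨fun _ => by linarith, fun _ => by linarith⟩
    · filter_upwards [gt_mem_nhds (show (0 : ℝ) < p - f c by linarith)] with δ hδ
      exact ⟨fun _ => by linarith, fun _ => by linarith⟩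
  obtain ⟨ε, hε, H⟩ := Metric.eventually_nhds_iff.1 (Filter.eventually_all.2 h)
  refine ⟨ε, hε, fun δ h0 h1 => H ?_⟩
  simpa [abs_of_pos h0] using h1

theorem gaps (p q : ℝ) : ∃ ε > 0, ∀ δ, 0 < δ → δ < ε → ∀ c,
    ((p < R.xl c → p + δ < R.xl c) ∧ (R.xr c < p → R.xr c < p - δ)) ∧
    ((q < R.yb c → q + δ < R.yb c) ∧ (R.yt c < q → R.yt c < q - δ)) := by
  obtain ⟨e1, h1, H1⟩ := gap_s12 R.xl p
  obtain ⟨e2, h2, H2⟩ := gap_s12 R.xr p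
  obtain ⟨e3, h3, H3⟩ := gap_s12 R.yb q
  obtain ⟨e4, h4, H4⟩ := gap_s12 R.yt q
  refine ⟨min (min e1 e2) (min e3 e4), by positivity, fun δ hδ hlt c => ?_⟩
  simp only [lt_min_iff] at hlt
  exact ⟨⟨(H1 δ hδ hlt.1.1 c).1, (H2 δ hδ hlt.1.2 c).2⟩,
    (H3 δ hδ hlt.2.1 c).1, (H4 δ hδ hlt.2.2 c).2⟩

theorem quadSE_s12 {p q : ℝ} (h1 : 0 ≤ p) (h2 : p < 1) (h3 : 0 < q) (h4 : q ≤ 1) :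
    ∃ c, R.xl c ≤ p ∧ p < R.xr c ∧ R.yb c < q ∧ q ≤ R.yt c := by
  obtain ⟨ε, hε, H⟩ := R.gaps p q
  obtain ⟨δ, hδ, hlt⟩ := exists_between
    (show 0 < min ε (min (1 - p) q) from lt_min hε (lt_min (by linarith) h3))
  simp only [lt_min_iff] at hlt
  obtain ⟨c, c1, c2, c3, c4⟩ := R.cover (p + δ, q - δ) (by dsimp; linarith) (by dsimp; linarith)
    (by dsimp; linarith) (by dsimp; linarith)
  dsimp only at c1 c2 c3 c4
  obtain ⟨⟨a, b⟩, a', b'⟩ := H δ hδ hlt.1 c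
  refine ⟨c, ?_, by linarith, by linarith, ?_⟩
  · by_contra hh
    linarith [a (not_le.1 hh)]
  · by_contra hh
    linarith [b' (not_le.1 hh)]

theorem quadNW_s12 {p q : ℝ} (h1 : 0 < p) (h2 : p ≤ 1) (h3 : 0 ≤ q) (h4 : q < 1) :
    ∃ c, R.xl c < p ∧ p ≤ R.xr c ∧ R.yb c ≤ q ∧ q < R.yt c := by
  obtain ⟨ε, hε, H⟩ := R.gaps p q
  obtain ⟨δ, hδ, hlt⟩ := exists_between
    (show 0 < min ε (min p (1 - q)) from lt_min hε (lt_min h1 (by linarith)))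
  simp only [lt_min_iff] at hlt
  obtain ⟨c, c1, c2, c3, c4⟩ := R.cover (p - δ, q + δ) (by dsimp; linarith) (by dsimp; linarith)
    (by dsimp; linarith) (by dsimp; linarith)
  dsimp only at c1 c2 c3 c4
  obtain ⟨⟨a, b⟩, a', b'⟩ := H δ hδ hlt.1 c
  refine ⟨c, by linarith, ?_, ?_, by linarith⟩
  · by_contra hh
    linarith [b (not_le.1 hh)]
  · by_contra hh
    linarith [a' (not_le.1 hh)]

theorem quadNE_s12 {p q : ℝ} (h1 : 0 ≤ p) (h2 : p < 1) (h3 : 0 ≤ q) (h4 : q < 1) :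
    ∃ c, R.xl c ≤ p ∧ p < R.xr c ∧ R.yb c ≤ q ∧ q < R.yt c := by
  obtain ⟨ε, hε, H⟩ := R.gaps p q
  obtain ⟨δ, hδ, hlt⟩ := exists_between
    (show 0 < min ε (min (1 - p) (1 - q)) from lt_min hε (lt_min (by linarith) (by linarith)))
  simp only [lt_min_iff] at hlt
  obtain ⟨c, c1, c2, c3, c4⟩ := R.cover (p + δ, q + δ) (by dsimp; linarith) (by dsimp; linarith)
    (by dsimp; linarith) (by dsimp; linarith)
  dsimp only at c1 c2 c3 c4
  obtain ⟨⟨a, b⟩, a', b'⟩ := H δ hδ hlt.1 c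
  refine ⟨c, ?_, by linarith, ?_, by linarith⟩
  · by_contra hh
    linarith [a (not_le.1 hh)]
  · by_contra hh
    linarith [a' (not_le.1 hh)]

theorem quadSW_s12 {p q : ℝ} (h1 : 0 < p) (h2 : p ≤ 1) (h3 : 0 < q) (h4 : q ≤ 1) :
    ∃ c, R.xl c < p ∧ p ≤ R.xr c ∧ R.yb c < q ∧ q ≤ R.yt c := by
  obtain ⟨ε, hε, H⟩ := R.gaps p q
  obtain ⟨δ, hδ, hlt⟩ := exists_between
    (show 0 < min ε (min p q) from lt_min hε (lt_min h1 h3))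
  simp only [lt_min_iff] at hlt
  obtain ⟨c, c1, c2, c3, c4⟩ := R.cover (p - δ, q - δ) (by dsimp; linarith) (by dsimp; linarith)
    (by dsimp; linarith) (by dsimp; linarith)
  dsimp only at c1 c2 c3 c4
  obtain ⟨⟨a, b⟩, a', b'⟩ := H δ hδ hlt.1 c
  refine ⟨c, by linarith, ?_, by linarith, ?_⟩
  · by_contra hh
    linarith [b (not_le.1 hh)]
  · by_contra hh
    linarith [b' (not_le.1 hh)]

/-- If some interior point of `u` is strictly south-west of an interior point of `v`, then `u`
precedes `v` in the adjacency poset. -/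
theorem adj_path (v : Fin n) : ∀ u, u ≠ v → R.xl u < R.xr v → R.yb u < R.yt v →
    Relation.TransGen R.AdjStep u v := by
  let f : Fin n → ℝ := fun u => min (R.xr u) (R.xr v) + min (R.yt u) (R.yt v)
  have wf : WellFounded (fun a b : Fin n => f b < f a) := by
    have : IsTrans (Fin n) (fun a b : Fin n => f b < f a) := ⟨fun a b c h1 h2 => lt_trans h2 h1⟩
    have : Std.Irrefl (fun a b : Fin n => f b < f a) := ⟨fun a => lt_irrefl _⟩
    exact Finite.wellFounded_of_trans_of_irrefl _
  intro u
  induction u using wf.induction with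
  | _ u ih =>
  intro huv hx hy
  have step : ∀ w, R.AdjStep u w → R.xl w < R.xr v → R.yb w < R.yt v → f u < f w →
      Relation.TransGen R.AdjStep u v := by
    intro w h1 h2 h3 h4
    by_cases hwv : w = v
    · subst hwv
      exact Relation.TransGen.single h1
    · exact Relation.TransGen.head h1 (ih w h4 hwv h2 h3)
  have a1 := R.lt_x u
  have a2 := R.lt_y u
  have a3 := R.lt_x v
  have a4 := R.lt_y v
  have b1 := R.xl_nonneg u
  have b2 := R.yb_nonneg u
  have b3 := R.xr_le_one v
  have b4 := R.yt_le_one v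
  have hY : R.yb u < min (R.yt u) (R.yt v) := lt_min a2 hy
  have hY1 := min_le_left (R.yt u) (R.yt v)
  have hY2 := min_le_right (R.yt u) (R.yt v)
  rcases lt_or_ge (R.xr u) (R.xr v) with h | h
  · obtain ⟨w, w1, w2, w3, w4⟩ := R.quadSE_s12 (p := R.xr u) (q := min (R.yt u) (R.yt v))
      (by linarith) (by linarith) (by linarith) (by linarith)
    have huw : u ≠ w := by rintro rfl; linarith
    have e : R.xr u ≤ R.xl w := by
      rcases R.disj huw with h | h | h | h <;> linarith
    refine step w (Or.inl ⟨by linarith, ?_⟩) (by linarith) (by linarith) ?_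
    · exact (max_lt hY w3).trans_le (le_min hY1 w4)
    · have c1 : R.xr u < min (R.xr w) (R.xr v) := lt_min w2 h
      have c2 : min (R.yt u) (R.yt v) ≤ min (R.yt w) (R.yt v) := le_min w4 hY2
      have c3 := min_le_left (R.xr u) (R.xr v)
      show _ + _ < _ + _
      linarith
  · have hv : R.yt u ≤ R.yb v := by
      rcases R.disj huv with h | h | h | h <;> linarith
    obtain ⟨w, w1, w2, w3, w4⟩ := R.quadNW_s12 (p := R.xr v) (q := R.yt u)
      (by linarith) (by linarith) (by linarith) (by linarith)
    have huw : u ≠ w := by rintro rfl; linarith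
    have e : R.yt u ≤ R.yb w := by
      rcases R.disj huw with h | h | h | h <;> linarith
    refine step w (Or.inr ⟨by linarith, ?_⟩) (by linarith) (by linarith) ?_
    · exact (max_lt hx w1).trans_le (le_min h w2)
    · have c1 : R.yt u < min (R.yt w) (R.yt v) := lt_min w4 (by linarith)
      have c2 : R.xr v ≤ min (R.xr w) (R.xr v) := le_min w2 le_rfl
      have c3 := min_le_right (R.xr u) (R.xr v)
      show _ + _ < _ + _
      linarith

/-- Reflection of a rectangulation in a horizontal axis. -/
def flipY : Rectangulation n where
  xl := R.xl
  xr := R.xr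
  yb := fun i => 1 - R.yt i
  yt := fun i => 1 - R.yb i
  lt_x := R.lt_x
  lt_y := fun i => by linarith [R.lt_y i]
  xl_nonneg := R.xl_nonneg
  xr_le_one := R.xr_le_one
  yb_nonneg := fun i => by linarith [R.yt_le_one i]
  yt_le_one := fun i => by linarith [R.yb_nonneg i]
  interiors_disjoint := by
    rintro i j hij ⟨⟨x, y⟩, ⟨h1, h2, h3, h4⟩, h5, h6, h7, h8⟩
    dsimp only at *
    exact R.interiors_disjoint i j hij ⟨(x, 1 - y), ⟨h1, h2, by dsimp; linarith, by dsimp; linarith⟩,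
      h5, h6, by dsimp; linarith, by dsimp; linarith⟩
  cover := by
    rintro ⟨x, y⟩ h1 h2 h3 h4
    dsimp only at *
    obtain ⟨i, a, b, c, d⟩ := R.cover (x, 1 - y) h1 h2 (by dsimp; linarith) (by dsimp; linarith)
    dsimp only at *
    exact ⟨i, a, b, by linarith, by linarith⟩

theorem dirRightOf_of_adj {u v : Fin n} (h : R.xr u = R.xl v)
    (hy : max (R.yb u) (R.yb v) < min (R.yt u) (R.yt v)) : R.DirRightOf v u := by
  have a1 := R.lt_x u
  have a3 := R.lt_x v
  have b1 := R.xl_nonneg u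
  have b3 := R.xr_le_one v
  simp only [max_lt_iff, lt_min_iff] at hy
  refine ⟨h.symm, by linarith, by linarith, fun y h1 h2 => ?_⟩
  rw [min_le_iff] at h1
  rw [le_max_iff] at h2
  by_cases hh : R.yb u ≤ y ∧ y ≤ R.yt u
  · exact ⟨u, Or.inr h.symm, hh.1, hh.2⟩
  · refine ⟨v, Or.inl rfl, ?_, ?_⟩
    · show R.yb v ≤ y
      by_contra hc
      exact hh ⟨by rcases h1 with h1 | h1 <;> linarith, by linarith⟩
    · show y ≤ R.yt v
      by_contra hc
      exact hh ⟨by linarith, by rcases h2 with h2 | h2 <;> linarith⟩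

theorem dirAbove_of_adj {u v : Fin n} (h : R.yb u = R.yt v)
    (hy : max (R.xl u) (R.xl v) < min (R.xr u) (R.xr v)) : R.DirAbove u v := by
  have a1 := R.lt_y u
  have a3 := R.lt_y v
  have b1 := R.yb_nonneg v
  have b3 := R.yt_le_one u
  simp only [max_lt_iff, lt_min_iff] at hy
  refine ⟨h, by linarith, by linarith, fun y h1 h2 => ?_⟩
  rw [min_le_iff] at h1
  rw [le_max_iff] at h2
  by_cases hh : R.xl u ≤ y ∧ y ≤ R.xr u
  · exact ⟨u, Or.inl rfl, hh.1, hh.2⟩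
  · refine ⟨v, Or.inr h, ?_, ?_⟩
    · show R.xl v ≤ y
      by_contra hc
      exact hh ⟨by rcases h1 with h1 | h1 <;> linarith, by linarith⟩
    · show y ≤ R.xr v
      by_contra hc
      exact hh ⟨by linarith, by rcases h2 with h2 | h2 <;> linarith⟩

theorem inorder_path {u v : Fin n} (huv : u ≠ v) (hx : R.xl u < R.xr v) (hy : R.yb v < R.yt u) :
    R.InorderLT u v := by
  have h := R.flipY.adj_path v u huv hx (show 1 - R.yt u < 1 - R.yb v by linarith)
  refine Relation.TransGen.mono ?_ _ _ h
  rintro a b (⟨h1, h2⟩ | ⟨h1, h2⟩)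
  · refine Or.inl (Relation.TransGen.single (R.dirRightOf_of_adj h1 ?_))
    change max (1 - R.yt a) (1 - R.yt b) < min (1 - R.yb a) (1 - R.yb b) at h2
    simp only [max_lt_iff, lt_min_iff] at h2 ⊢
    exact ⟨⟨by linarith, by linarith⟩, by linarith, by linarith⟩
  · change 1 - R.yb a = 1 - R.yt b at h1
    exact Or.inr (Relation.TransGen.single (R.dirAbove_of_adj (by linarith) h2))

/-- Two rectangles touching diagonally at a point contradict genericity. -/
theorem no_cross (hgen : R.Generic) {i j : Fin n} (hx : R.xr i = R.xl j) (hy : R.yb i = R.yt j) :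
    False := by
  have a1 := R.lt_x i
  have a2 := R.lt_y i
  have a3 := R.lt_x j
  have a4 := R.lt_y j
  have b1 := R.xl_nonneg i
  have b2 := R.yb_nonneg j
  have b3 := R.xr_le_one j
  have b4 := R.yt_le_one i
  obtain ⟨c, c1, c2, c3, c4⟩ := R.quadSW_s12 (p := R.xr i) (q := R.yb i)
    (by linarith) (by linarith) (by linarith) (by linarith)
  obtain ⟨d, d1, d2, d3, d4⟩ := R.quadNE_s12 (p := R.xr i) (q := R.yb i)
    (by linarith) (by linarith) (by linarith) (by linarith)
  have hci : c ≠ i := by rintro rfl; linarith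
  have hcj : c ≠ j := by rintro rfl; linarith
  have hdi : d ≠ i := by rintro rfl; linarith
  have hdj : d ≠ j := by rintro rfl; linarith
  have hij : i ≠ j := by rintro rfl; linarith
  have e1 : R.yt c ≤ R.yb i := by rcases R.disj hci with h | h | h | h <;> linarith
  have e2 : R.xr c ≤ R.xl j := by rcases R.disj hcj with h | h | h | h <;> linarith
  have e3 : R.xr i ≤ R.xl d := by rcases R.disj hdi with h | h | h | h <;> linarith
  have e4 : R.yt j ≤ R.yb d := by rcases R.disj hdj with h | h | h | h <;> linarith
  have hcd : c ≠ d := by rintro rfl; linarith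
  exact hgen ⟨(R.xr i, R.yb i), i, j, c, d, hij, hci.symm, hdi.symm, hcj.symm, hdj.symm, hcd,
    ⟨Or.inr rfl, Or.inl rfl⟩, ⟨Or.inl hx, Or.inr hy⟩,
    ⟨Or.inr (by dsimp; linarith), Or.inr (by dsimp; linarith)⟩,
    ⟨Or.inl (by dsimp; linarith), Or.inl (by dsimp; linarith)⟩⟩

/-- A horizontal segment cannot run through a vertical one. -/
theorem no_cross' (hgen : R.Generic) {c c' : Fin n} {B : ℝ} (he : R.TEdgeV c c')
    (hB : R.xr c < B) (hB1 : B ≤ 1)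
    (hh : ∀ x, R.xr c ≤ x → x ≤ B → R.OnHorizEdge (x, R.yt c)) : False := by
  obtain ⟨hx, hy⟩ := he
  have a1 := R.lt_x c
  have a2 := R.lt_y c
  have a3 := R.lt_x c'
  have a4 := R.lt_y c'
  have b1 := R.xl_nonneg c
  have b2 := R.yb_nonneg c
  have b4 := R.yt_le_one c'
  have key : ∀ d, R.xl d ≤ R.xr c → R.xr c < R.xr d → R.yb d < R.yt c → R.yt c < R.yt d →
      False := by
    intro d d1 d2 d3 d4
    obtain ⟨x, x1, x2⟩ := exists_between (lt_min hB d2)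
    rw [lt_min_iff] at x2
    obtain ⟨e, e1, e2, e3⟩ := hh x x1.le x2.1.le
    dsimp only at e1 e2 e3
    have hed : e ≠ d := by
      rintro rfl
      rcases e1 with h | h <;> linarith
    have := R.lt_y e
    rcases e1 with h' | h' <;> rcases R.disj hed with h | h | h | h <;> linarith
  obtain ⟨d, d1, d2, d3, d4⟩ := R.quadSE_s12 (p := R.xr c) (q := R.yt c)
    (by linarith) (by linarith) (by linarith) (by linarith)
  obtain ⟨d', d1', d2', d3', d4'⟩ := R.quadNE_s12 (p := R.xr c) (q := R.yt c)
    (by linarith) (by linarith) (by linarith) (by linarith)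
  have e1 : R.yt d = R.yt c := by
    by_contra hne
    exact key d d1 d2 d3 (lt_of_le_of_ne d4 (Ne.symm hne))
  have e2 : R.yb d' = R.yt c := by
    by_contra hne
    exact key d' d1' d2' (lt_of_le_of_ne d3' hne) d4'
  have hdc : d ≠ c := by rintro rfl; linarith
  have hdc' : d' ≠ c' := by rintro rfl; linarith
  have e3 : R.xr c ≤ R.xl d := by rcases R.disj hdc with h | h | h | h <;> linarith
  have e4 : R.xr c' ≤ R.xl d' := by rcases R.disj hdc' with h | h | h | h <;> linarith
  have n1 : c ≠ c' := by rintro rfl; linarith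
  have n2 : c ≠ d' := by rintro rfl; linarith
  have n3 : c' ≠ d := by rintro rfl; linarith
  have n4 : d ≠ d' := by rintro rfl; linarith
  exact hgen ⟨(R.xr c, R.yt c), c, c', d, d', n1, hdc.symm, n2, n3, hdc'.symm, n4,
    ⟨Or.inr rfl, Or.inr rfl⟩, ⟨Or.inr hx.symm, Or.inl hy.symm⟩,
    ⟨Or.inl (by dsimp; linarith), Or.inr (by dsimp; linarith)⟩,
    ⟨Or.inl (by dsimp; linarith), Or.inl (by dsimp; linarith)⟩⟩

/-- Along a path of the target tree, right sides move right; if the right side stays put, the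
right sides fill an interval. -/
theorem treach_facts {a i : Fin n} (h : R.TReach a i) :
    R.xr a ≤ R.xr i ∧ (R.xr a = R.xr i → R.yb a ≤ R.yb i ∧ R.yt a ≤ R.yt i ∧
      ∀ y, R.yb a ≤ y → y ≤ R.yt i → R.OnVertEdge (R.xr i, y)) := by
  induction h with
  | refl => exact ⟨le_rfl, fun _ => ⟨le_rfl, le_rfl, fun y h1 h2 => ⟨a, Or.inr rfl, h1, h2⟩⟩⟩
  | @tail b c _ hbc ih =>
    have b1 := R.lt_x c
    have b2 := R.lt_y c
    have b3 := R.lt_y b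
    rcases hbc with ⟨h1, h2⟩ | ⟨h1, h2⟩
    · exact ⟨by linarith, fun h => by linarith [ih.1]⟩
    · refine ⟨by linarith [ih.1], fun h => ?_⟩
      obtain ⟨i1, i2, i3⟩ := ih.2 (by linarith)
      refine ⟨by linarith, by linarith, fun y hy1 hy2 => ?_⟩
      rcases le_total y (R.yt b) with hy | hy
      · rw [h1]
        exact i3 y hy1 hy
      · exact ⟨c, Or.inr rfl, by dsimp; linarith, hy2⟩

/-- Along a path of the source tree, left sides move right; if the left side stays put, the
left sides fill an interval. -/
theorem sreach_facts {j b : Fin n} (h : R.SReach j b) :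
    R.xl j ≤ R.xl b ∧ (R.xl j = R.xl b → R.yb j ≤ R.yb b ∧ R.yt j ≤ R.yt b ∧
      ∀ y, R.yb j ≤ y → y ≤ R.yt b → R.OnVertEdge (R.xl b, y)) := by
  induction h with
  | refl => exact ⟨le_rfl, fun _ => ⟨le_rfl, le_rfl, fun y h1 h2 => ⟨j, Or.inl rfl, h1, h2⟩⟩⟩
  | @tail b c _ hbc ih =>
    have b0 := R.lt_x b
    have b1 := R.lt_x c
    have b2 := R.lt_y c
    have b3 := R.lt_y b
    rcases hbc with ⟨h1, h2⟩ | ⟨h1, h2⟩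
    · exact ⟨by linarith [ih.1], fun h => by linarith [ih.1]⟩
    · refine ⟨by linarith [ih.1], fun h => ?_⟩
      obtain ⟨i1, i2, i3⟩ := ih.2 (by linarith)
      refine ⟨by linarith, by linarith, fun y hy1 hy2 => ?_⟩
      rcases le_total y (R.yt b) with hy | hy
      · rw [← h1]
        exact i3 y hy1 hy
      · exact ⟨c, Or.inl rfl, by dsimp; linarith, hy2⟩

theorem VSubT.reach {R : Rectangulation n} {i a : Fin n} (h : R.VSubT i a) : R.TReach a i := by
  obtain ⟨r, h1, h2⟩ := h
  exact Relation.ReflTransGen.tail h2 (Or.inr h1)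

theorem VSubS.reach {R : Rectangulation n} {j b : Fin n} (h : R.VSubS j b) : R.SReach j b := by
  obtain ⟨r, h1, h2⟩ := h
  exact Relation.ReflTransGen.head (Or.inr h1) h2

/-- Inside a horizontal segment, target tree paths follow the segment. -/
theorem treach_along (hgen : R.Generic) {a r : Fin n} {B : ℝ} (h : R.TReach a r) (hB1 : B ≤ 1)
    (hh : ∀ x, R.xr a ≤ x → x ≤ B → R.OnHorizEdge (x, R.yt a)) :
    R.xr r < B → R.yt r = R.yt a := by
  induction h with
  | refl => exact fun _ => rfl
  | @tail b c hab hbc ih =>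
    intro hc
    have b1 := R.lt_x c
    have f := (R.treach_facts hab).1
    rcases hbc with ⟨h1, h2⟩ | ⟨h1, h2⟩
    · rw [h2]
      exact ih (by linarith)
    · exfalso
      have e := ih (by linarith)
      refine R.no_cross' hgen (c := b) (c' := c) (B := B) ⟨h1, h2⟩ (by linarith) hB1 ?_
      intro x x1 x2
      rw [e]
      exact hh x (by linarith) x2

end Rectangulation


/-- if `i < j`, `j ≺_s^R i` does not hold and
`cv^{T,S}_{i,j} > 0`, then the vertical pattern `i‖j` holds. -/
theorem common_leaves_vertical_pattern (n : ℕ) (R : Rectangulation n)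
    (hgen : R.Generic) (hlab : R.InorderLabeled)
    (i j : Fin n) (hij : i < j) (hns : ¬ R.PrecS j i) (hcv : 0 < R.cv i j) :
    R.VertPattern i j := by
  have hne : j ≠ i := hij.ne'
  have hns' : ∀ h : Relation.TransGen R.AdjStep j i, False := fun h =>
    hns (Relation.TransGen.mono (fun _ _ h => Or.inl h) _ _ h)
  have hge : R.xr i ≤ R.xl j := by
    by_contra hc
    push Not at hc
    have a2 := R.lt_y i
    have a4 := R.lt_y j
    have h1 : ¬ R.yb j < R.yt i := fun h => hns' (R.adj_path i j hne hc h)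
    have h2 : ¬ R.yb i < R.yt j := fun h =>
      absurd ((hlab j i).1 (R.inorder_path hne hc h)) (not_lt.2 hij.le)
    linarith
  obtain ⟨⟨a, b⟩, h⟩ := Set.nonempty_of_ncard_ne_zero (Nat.pos_iff_ne_zero.1 hcv)
  rcases h with ⟨⟨-, -, hab, hs0, hs1, hs⟩, ha, hb⟩ | ⟨⟨-, -, hab, hs0, hs1, hs⟩, ha, hb⟩
  · dsimp only at *
    have ha' : R.TReach a i := by
      rcases ha with h | h
      · exact h.reach
      · rw [h]; exact Relation.ReflTransGen.refl
    have hb' : R.SReach j b := by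
      rcases hb with h | h
      · exact h.reach
      · rw [h]; exact Relation.ReflTransGen.refl
    obtain ⟨t1, t2⟩ := R.treach_facts ha'
    obtain ⟨s1, s2⟩ := R.sreach_facts hb'
    have e : R.xr i = R.xl j := by linarith
    have ea : R.xr a = R.xr i := by linarith
    have eb : R.xl b = R.xr i := by linarith
    obtain ⟨t3, t4, t5⟩ := t2 ea
    obtain ⟨s3, s4, s5⟩ := s2 (by linarith)
    rw [ea] at hs hs0 hs1
    rw [eb] at s5
    have hseg : R.SameVSeg (R.xr i) (R.yb i) (R.yt i) (R.yb j) (R.yt j) := by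
      refine ⟨hs0, hs1, fun y h1 h2 => ?_⟩
      by_cases c1 : R.yb a ≤ y ∧ y ≤ R.yt i
      · exact t5 y c1.1 c1.2
      by_cases c2 : R.yb j ≤ y ∧ y ≤ R.yt b
      · exact s5 y c2.1 c2.2
      have := R.lt_y a
      have := R.lt_y b
      refine hs y ?_ ?_
      · rw [min_le_iff] at h1 ⊢
        by_contra hc
        push Not at hc
        rcases h1 with h1 | h1
        · linarith
        · exact c2 ⟨h1, by linarith⟩
      · rw [le_max_iff] at h2 ⊢
        by_contra hc
        push Not at hc
        rcases h2 with h2 | h2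
        · exact c1 ⟨by linarith, h2⟩
        · linarith
    refine ⟨e, hseg, ?_⟩
    by_contra hc
    rcases (not_lt.1 hc).lt_or_eq with h | h
    · refine hns (Relation.TransGen.single (Or.inr (Or.inl ⟨e, ?_, h⟩)))
      rw [← e]
      exact hseg
    · exact R.no_cross hgen e h.symm
  · exfalso
    dsimp only at *
    obtain ⟨s1, -⟩ := R.sreach_facts hb.reach
    obtain ⟨r, hr, har⟩ := ha
    have b1 := R.lt_x b
    have b0 := R.lt_x a
    have hB : R.xr r < R.xr b := by linarith [hr.1]
    have hh : ∀ x, R.xr a ≤ x → x ≤ R.xr b → R.OnHorizEdge (x, R.yt a) := fun x x1 x2 =>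
      hs x (min_le_iff.2 (Or.inl (by linarith))) (le_max_iff.2 (Or.inr x2))
    have e := R.treach_along hgen har (R.xr_le_one b) hh hB
    refine R.no_cross' hgen hr hB (R.xr_le_one b) fun x x1 x2 => ?_
    rw [e]
    exact hh x (by linarith [(R.treach_facts har).1]) x2

end
end

section
/- A permutation σ of [n] avoids both vincular patterns 2–41–3 and 3–41–2 (i.e., σ is a twisted Baxter permutation) if and only if for every descent position q of σ (i.e., σ_q > σ_{q+1}), at least one of the two sets A_q = {σ_p : p < q and σ_{q+1} < σ_p < σ_q} and B_q = {σ_r : r > q+1 and σ_{q+1} < σ_r < σ_q} is empty. Equivalently, σ is twisted Baxter if and only if every arc of its noncrossing arc diagram does not cross the horizontal line, i.e., is an up arc or a down arc. -/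
open Classical

/-- a permutation `σ` of `[n]` avoids the vincular patterns
`2-41-3` and `3-41-2` (i.e. is a twisted Baxter permutation) if and only if for
every descent position `q` of `σ`, at least one of the sets
`A_q = {σ_p : p < q, σ_{q+1} < σ_p < σ_q}` and
`B_q = {σ_r : r > q+1, σ_{q+1} < σ_r < σ_q}` is empty — equivalently, every arc
of the noncrossing arc diagram of `σ` does not cross the horizontal line. -/
theorem twisted_baxter_characterization (n : ℕ) (σ : Equiv.Perm (Fin n)) :
    ((¬ ∃ (p q r : Fin n) (h : (q : ℕ) + 1 < n),
        p < q ∧ (⟨(q : ℕ) + 1, h⟩ : Fin n) < r ∧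
        σ ⟨(q : ℕ) + 1, h⟩ < σ p ∧ σ p < σ r ∧ σ r < σ q) ∧
      (¬ ∃ (p q r : Fin n) (h : (q : ℕ) + 1 < n),
        p < q ∧ (⟨(q : ℕ) + 1, h⟩ : Fin n) < r ∧
        σ ⟨(q : ℕ) + 1, h⟩ < σ r ∧ σ r < σ p ∧ σ p < σ q)) ↔
    (∀ (q : Fin n) (h : (q : ℕ) + 1 < n), σ ⟨(q : ℕ) + 1, h⟩ < σ q →
      {v : Fin n | ∃ p, p < q ∧ σ p = v ∧ σ ⟨(q : ℕ) + 1, h⟩ < v ∧ v < σ q} = ∅ ∨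
      {v : Fin n | ∃ r, (⟨(q : ℕ) + 1, h⟩ : Fin n) < r ∧ σ r = v ∧
        σ ⟨(q : ℕ) + 1, h⟩ < v ∧ v < σ q} = ∅) := by
  constructor
  · rintro ⟨h1, h2⟩ q h _
    by_contra! hne
    obtain ⟨⟨v, p, hp, rfl, hp1, hp2⟩, ⟨w, r, hr, rfl, hr1, hr2⟩⟩ := hne
    rcases lt_trichotomy (σ p) (σ r) with hlt | heq | hgt
    · exact h1 ⟨p, q, r, h, hp, hr, hp1, hlt, hr2⟩
    · have hpr : p = r := σ.injective heq
      subst hpr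
      have a1 : (p : ℕ) < q := hp
      have a2 : (q : ℕ) + 1 < p := hr
      omega
    · exact h2 ⟨p, q, r, h, hp, hr, hr1, hgt, hp2⟩
  · intro H
    have key : ∀ (p q r : Fin n) (h : (q : ℕ) + 1 < n), p < q →
        (⟨(q : ℕ) + 1, h⟩ : Fin n) < r →
        σ ⟨(q : ℕ) + 1, h⟩ < σ p → σ p < σ q →
        σ ⟨(q : ℕ) + 1, h⟩ < σ r → σ r < σ q → False := by
      intro p q r h hp hr hp1 hp2 hr1 hr2
      rcases H q h (hp1.trans hp2) with hA | hB
      · exact Set.eq_empty_iff_forall_notMem.mp hA (σ p) ⟨p, hp, rfl, hp1, hp2⟩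
      · exact Set.eq_empty_iff_forall_notMem.mp hB (σ r) ⟨r, hr, rfl, hr1, hr2⟩
    constructor
    · rintro ⟨p, q, r, h, hp, hr, a, b, c⟩
      exact key p q r h hp hr a (b.trans c) (a.trans b) c
    · rintro ⟨p, q, r, h, hp, hr, a, b, c⟩
      exact key p q r h hp hr (a.trans b) c a (b.trans c)
end

section
/- A permutation σ of [n] avoids all four vincular patterns 24–51–3, 42–51–3, 3–51–24 and 3–51–42 (i.e., σ is a 2-clumped permutation) if and only if for every descent position q of σ (i.e., σ_q > σ_{q+1}), the sets A_q = {σ_p : p < q and σ_{q+1} < σ_p < σ_q} and B_q = {σ_r : r > q+1 and σ_{q+1} < σ_r < σ_q} are separated, meaning that either every element of A_q is smaller than every element of B_q, or every element of A_q is larger than every element of B_q. Equivalently, σ is 2-clumped if and only if every arc of its noncrossing arc diagram crosses the horizontal line at most once. -/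
open Classical

/-- a permutation `σ` of `[n]` avoids the vincular patterns
`24-51-3`, `42-51-3`, `3-51-24` and `3-51-42` (i.e. is a 2-clumped permutation)
if and only if for every descent position `q` of `σ`, the sets
`A_q = {σ_p : p < q, σ_{q+1} < σ_p < σ_q}` and
`B_q = {σ_r : r > q+1, σ_{q+1} < σ_r < σ_q}` are separated (every element of
`A_q` is smaller than every element of `B_q`, or every element of `A_q` is
larger than every element of `B_q`) — equivalently, every arc of the
noncrossing arc diagram of `σ` crosses the horizontal line at most once. -/
theorem two_clumped_characterization (n : ℕ) (σ : Equiv.Perm (Fin n)) :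
    ((¬ ∃ (p₁ p₂ q r : Fin n) (h : (q : ℕ) + 1 < n),
        p₁ < p₂ ∧ p₂ < q ∧ (⟨(q : ℕ) + 1, h⟩ : Fin n) < r ∧
        σ ⟨(q : ℕ) + 1, h⟩ < σ p₁ ∧ σ p₁ < σ r ∧ σ r < σ p₂ ∧ σ p₂ < σ q) ∧
      (¬ ∃ (p₁ p₂ q r : Fin n) (h : (q : ℕ) + 1 < n),
        p₁ < p₂ ∧ p₂ < q ∧ (⟨(q : ℕ) + 1, h⟩ : Fin n) < r ∧
        σ ⟨(q : ℕ) + 1, h⟩ < σ p₂ ∧ σ p₂ < σ r ∧ σ r < σ p₁ ∧ σ p₁ < σ q) ∧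
      (¬ ∃ (p q r₁ r₂ : Fin n) (h : (q : ℕ) + 1 < n),
        p < q ∧ (⟨(q : ℕ) + 1, h⟩ : Fin n) < r₁ ∧ r₁ < r₂ ∧
        σ ⟨(q : ℕ) + 1, h⟩ < σ r₁ ∧ σ r₁ < σ p ∧ σ p < σ r₂ ∧ σ r₂ < σ q) ∧
      (¬ ∃ (p q r₁ r₂ : Fin n) (h : (q : ℕ) + 1 < n),
        p < q ∧ (⟨(q : ℕ) + 1, h⟩ : Fin n) < r₁ ∧ r₁ < r₂ ∧
        σ ⟨(q : ℕ) + 1, h⟩ < σ r₂ ∧ σ r₂ < σ p ∧ σ p < σ r₁ ∧ σ r₁ < σ q)) ↔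
    (∀ (q : Fin n) (h : (q : ℕ) + 1 < n), σ ⟨(q : ℕ) + 1, h⟩ < σ q →
      (∀ a ∈ {v : Fin n | ∃ p, p < q ∧ σ p = v ∧ σ ⟨(q : ℕ) + 1, h⟩ < v ∧ v < σ q},
        ∀ b ∈ {v : Fin n | ∃ r, (⟨(q : ℕ) + 1, h⟩ : Fin n) < r ∧ σ r = v ∧
          σ ⟨(q : ℕ) + 1, h⟩ < v ∧ v < σ q}, a < b) ∨
      (∀ a ∈ {v : Fin n | ∃ p, p < q ∧ σ p = v ∧ σ ⟨(q : ℕ) + 1, h⟩ < v ∧ v < σ q},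
        ∀ b ∈ {v : Fin n | ∃ r, (⟨(q : ℕ) + 1, h⟩ : Fin n) < r ∧ σ r = v ∧
          σ ⟨(q : ℕ) + 1, h⟩ < v ∧ v < σ q}, b < a)) := by
  constructor
  · rintro ⟨h1, h2, h3, h4⟩ q h hq
    -- no `B` value lies between two `A` values
    have HA : ∀ p p' r : Fin n, p < q → p' < q → (⟨(q : ℕ) + 1, h⟩ : Fin n) < r →
        σ ⟨(q : ℕ) + 1, h⟩ < σ p → σ p < σ r → σ r < σ p' → σ p' < σ q → False := by
      intro p p' r hp hp' hr k1 k2 k3 k4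
      rcases lt_trichotomy p p' with hlt | heq | hgt
      · exact h1 ⟨p, p', q, r, h, hlt, hp', hr, k1, k2, k3, k4⟩
      · subst heq
        exact lt_asymm k2 k3
      · exact h2 ⟨p', p, q, r, h, hgt, hp, hr, k1, k2, k3, k4⟩
    -- no `A` value lies between two `B` values
    have HB : ∀ p r r' : Fin n, p < q → (⟨(q : ℕ) + 1, h⟩ : Fin n) < r →
        (⟨(q : ℕ) + 1, h⟩ : Fin n) < r' →
        σ ⟨(q : ℕ) + 1, h⟩ < σ r → σ r < σ p → σ p < σ r' → σ r' < σ q → False := by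
      intro p r r' hp hr hr' k1 k2 k3 k4
      rcases lt_trichotomy r r' with hlt | heq | hgt
      · exact h3 ⟨p, q, r, r', h, hp, hr, hlt, k1, k2, k3, k4⟩
      · subst heq
        exact lt_asymm k2 k3
      · exact h4 ⟨p, q, r', r, h, hp, hr', hgt, k1, k2, k3, k4⟩
    -- `A` and `B` values are distinct
    have HN : ∀ p r : Fin n, p < q → (⟨(q : ℕ) + 1, h⟩ : Fin n) < r → σ p ≠ σ r := by
      intro p r hp hr heq
      have hpr := σ.injective heq
      subst hpr
      simp only [Fin.lt_def] at hp hr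
      omega
    by_contra hcon
    rw [not_or] at hcon
    obtain ⟨c1, c2⟩ := hcon
    apply c1
    rintro _ ⟨p, hp, rfl, kp1, kp2⟩ _ ⟨r, hr, rfl, kr1, kr2⟩
    by_contra hlt
    have hrp : σ r < σ p := lt_of_le_of_ne (not_lt.mp hlt) (HN p r hp hr).symm
    apply c2
    rintro _ ⟨p', hp', rfl, kp1', kp2'⟩ _ ⟨r', hr', rfl, kr1', kr2'⟩
    by_contra hlt'
    have hpr' : σ p' < σ r' := lt_of_le_of_ne (not_lt.mp hlt') (HN p' r' hp' hr')
    rcases lt_or_gt_of_ne (HN p' r hp' hr) with hc | hc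
    · exact HA p' p r hp' hp hr kp1' hc hrp kp2
    · exact HB p' r r' hp' hr hr' kr1 hc hpr' kr2'
  · intro H
    refine ⟨?_, ?_, ?_, ?_⟩
    · rintro ⟨p₁, p₂, q, r, h, hp, hq, hr, k1, k2, k3, k4⟩
      have hA1 := k2.trans (k3.trans k4)
      have hB := k1.trans k2
      rcases H q h (k1.trans hA1) with hs | hs
      · exact lt_asymm k3 (hs _ ⟨p₂, hq, rfl, hB.trans k3, k4⟩ _ ⟨r, hr, rfl, hB, k3.trans k4⟩)
      · exact lt_asymm k2 (hs _ ⟨p₁, hp.trans hq, rfl, k1, hA1⟩ _ ⟨r, hr, rfl, hB, k3.trans k4⟩)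
    · rintro ⟨p₁, p₂, q, r, h, hp, hq, hr, k1, k2, k3, k4⟩
      have hA1 := k2.trans (k3.trans k4)
      have hB := k1.trans k2
      rcases H q h (k1.trans hA1) with hs | hs
      · exact lt_asymm k3 (hs _ ⟨p₁, hp.trans hq, rfl, hB.trans k3, k4⟩ _
          ⟨r, hr, rfl, hB, k3.trans k4⟩)
      · exact lt_asymm k2 (hs _ ⟨p₂, hq, rfl, k1, hA1⟩ _ ⟨r, hr, rfl, hB, k3.trans k4⟩)
    · rintro ⟨p, q, r₁, r₂, h, hp, hr, hrr, k1, k2, k3, k4⟩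
      have hB1 := k2.trans (k3.trans k4)
      have hA := k1.trans k2
      rcases H q h (k1.trans hB1) with hs | hs
      · exact lt_asymm k2 (hs _ ⟨p, hp, rfl, hA, k3.trans k4⟩ _ ⟨r₁, hr, rfl, k1, hB1⟩)
      · exact lt_asymm k3 (hs _ ⟨p, hp, rfl, hA, k3.trans k4⟩ _
          ⟨r₂, hr.trans hrr, rfl, hA.trans k3, k4⟩)
    · rintro ⟨p, q, r₁, r₂, h, hp, hr, hrr, k1, k2, k3, k4⟩
      have hB1 := k2.trans (k3.trans k4)
      have hA := k1.trans k2
      rcases H q h (k1.trans hB1) with hs | hs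
      · exact lt_asymm k2 (hs _ ⟨p, hp, rfl, hA, k3.trans k4⟩ _
          ⟨r₂, hr.trans hrr, rfl, k1, hB1⟩)
      · exact lt_asymm k3 (hs _ ⟨p, hp, rfl, hA, k3.trans k4⟩ _ ⟨r₁, hr, rfl, hA.trans k3, k4⟩)
end
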